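/- arXiv:2002.05750 — 2 statements merged into one kernel-verified Lean document; each statement's English description precedes it below -/
import Mathlib

section
/- The M₃(1,2) balanced excited random walk on ℤ³ (where at a newly visited site the walk takes a uniform step in ±e₁, and at a previously visited site a uniform step in ±e₂, ±e₃) is transient: almost surely every site of ℤ³ is visited only finitely many times. -/
open MeasureTheory Filter

/-- The `i`-th canonical unit vector of `ℤ^d`. -/
def unitVec (d : ℕ) (i : Fin d) : Fin d → ℤ := fun j => if j = i then 1 else 0

/-- `S` is a balanced excited random walk `M_d(d₁,d₂)` under `P`:
it starts at `0` a.s., is measurable, and conditionally on any finite trajectory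
`S_0 = h 0, …, S_n = h n`, if `h n` is a new site the walk jumps to `h n ± e_i`
with probability `1/(2d₁)` for each `i < d₁` (`0`-indexed), while if `h n` is an
old site it jumps to `h n ± e_i` with probability `1/(2d₂)` for each
`d - d₂ ≤ i < d` (`0`-indexed). -/
def IsBERW {Ω : Type*} [MeasurableSpace Ω] (d d₁ d₂ : ℕ) (P : Measure Ω)
    (S : ℕ → Ω → Fin d → ℤ) : Prop :=
  (∀ n, Measurable (S n)) ∧
  (∀ᵐ ω ∂P, S 0 ω = 0) ∧
  (∀ (n : ℕ) (h : ℕ → Fin d → ℤ), (∀ k < n, h n ≠ h k) →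
    ∀ i : Fin d, i.1 < d₁ → ∀ ε : ℤ, ε = 1 ∨ ε = -1 →
      P {ω | (∀ k ≤ n, S k ω = h k) ∧ S (n + 1) ω = h n + ε • unitVec d i}
        = P {ω | ∀ k ≤ n, S k ω = h k} / (2 * d₁)) ∧
  (∀ (n : ℕ) (h : ℕ → Fin d → ℤ), (∃ k < n, h n = h k) →
    ∀ i : Fin d, d - d₂ ≤ i.1 → ∀ ε : ℤ, ε = 1 ∨ ε = -1 →
      P {ω | (∀ k ≤ n, S k ω = h k) ∧ S (n + 1) ω = h n + ε • unitVec d i}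
        = P {ω | ∀ k ≤ n, S k ω = h k} / (2 * d₂))

/-- Transience: almost surely, every site is visited only finitely many times. -/
def IsTransientWalk {Ω : Type*} [MeasurableSpace Ω] (d : ℕ) (P : Measure Ω)
    (S : ℕ → Ω → Fin d → ℤ) : Prop :=
  ∀ᵐ ω ∂P, ∀ x : Fin d → ℤ, {n : ℕ | S n ω = x}.Finite

namespace BERW

/-- The integer `±1` encoded by a Boolean. -/
def sgn (b : Bool) : ℤ := if b then 1 else -1

/-- A planar step in the rotated coordinates `(x + y, x - y)`. -/
def dvec (a : Bool × Bool) : ℤ × ℤ := (sgn a.1, sgn a.2)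

/-- The expectation of a function of `n` independent uniform planar steps. -/
noncomputable def pathMean : ℕ → (List (Bool × Bool) → ℝ) → ℝ
  | 0, f => f []
  | n + 1, f => (∑ a, pathMean n (fun l => f (a :: l))) / 4

lemma pathMean_mono {n : ℕ} {f g : List (Bool × Bool) → ℝ}
    (h : ∀ l, l.length = n → f l ≤ g l) : pathMean n f ≤ pathMean n g := by
  induction n generalizing f g with
  | zero => exact h [] rfl
  | succ n ih =>
    simp only [pathMean]
    gcongr with a
    exact ih fun l hl => h _ (by simp [hl])

lemma pathMean_congr {n : ℕ} {f g : List (Bool × Bool) → ℝ}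
    (h : ∀ l, l.length = n → f l = g l) : pathMean n f = pathMean n g :=
  le_antisymm (pathMean_mono fun l hl => (h l hl).le) (pathMean_mono fun l hl => (h l hl).ge)

lemma pathMean_const (n : ℕ) (c : ℝ) : pathMean n (fun _ => c) = c := by
  induction n with
  | zero => rfl
  | succ n ih => simp [pathMean, ih]

lemma pathMean_nonneg {n : ℕ} {f : List (Bool × Bool) → ℝ}
    (h : ∀ l, l.length = n → 0 ≤ f l) : 0 ≤ pathMean n f := by
  rw [← pathMean_const n 0]
  exact pathMean_mono h

lemma pathMean_le_const {n : ℕ} {f : List (Bool × Bool) → ℝ} {c : ℝ}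
    (h : ∀ l, l.length = n → f l ≤ c) : pathMean n f ≤ c := by
  rw [← pathMean_const n c]
  exact pathMean_mono h

lemma pathMean_add (n : ℕ) (f g : List (Bool × Bool) → ℝ) :
    pathMean n (fun l => f l + g l) = pathMean n f + pathMean n g := by
  induction n generalizing f g with
  | zero => rfl
  | succ n ih => simp only [pathMean, ih, Finset.sum_add_distrib, add_div]

lemma pathMean_const_mul (n : ℕ) (c : ℝ) (f : List (Bool × Bool) → ℝ) :
    pathMean n (fun l => c * f l) = c * pathMean n f := by
  induction n generalizing f with
  | zero => rfl
  | succ n ih => simp only [pathMean, ih, ← Finset.mul_sum, mul_div_assoc]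

lemma pathMean_mul_const (n : ℕ) (c : ℝ) (f : List (Bool × Bool) → ℝ) :
    pathMean n (fun l => f l * c) = pathMean n f * c := by
  simp only [mul_comm _ c, pathMean_const_mul]

lemma pathMean_sum {ι : Type*} (s : Finset ι) (n : ℕ) (f : ι → List (Bool × Bool) → ℝ) :
    pathMean n (fun l => ∑ i ∈ s, f i l) = ∑ i ∈ s, pathMean n (f i) := by
  classical
  induction s using Finset.induction_on with
  | empty => simpa using pathMean_const n 0
  | insert a s ha ih => simp only [Finset.sum_insert ha, pathMean_add, ih]

lemma pathMean_div_const (n : ℕ) (c : ℝ) (f : List (Bool × Bool) → ℝ) :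
    pathMean n (fun l => f l / c) = pathMean n f / c := by
  simp only [div_eq_mul_inv, pathMean_mul_const]

lemma pathMean_append (m n : ℕ) (f : List (Bool × Bool) → ℝ) :
    pathMean (m + n) f = pathMean m (fun l => pathMean n (fun l' => f (l ++ l'))) := by
  induction m generalizing f with
  | zero => simp [pathMean]
  | succ m ih =>
    rw [show m + 1 + n = (m + n) + 1 by ring]
    simp only [pathMean, ih, List.cons_append]

lemma pathMean_concat (n : ℕ) (f : List (Bool × Bool) → ℝ) :
    pathMean (n + 1) f = (∑ a, pathMean n (fun l => f (l ++ [a]))) / 4 := by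
  rw [pathMean_append]
  simp only [pathMean, pathMean_div_const, pathMean_sum]

lemma pathMean_reverse (n : ℕ) (f : List (Bool × Bool) → ℝ) :
    pathMean n (fun l => f l.reverse) = pathMean n f := by
  induction n generalizing f with
  | zero => rfl
  | succ n ih =>
    rw [pathMean_concat]
    simp only [pathMean, List.reverse_append, List.reverse_cons, List.reverse_nil, List.nil_append,
      List.cons_append]
    congr 1
    exact Finset.sum_congr rfl fun a _ => ih (fun l => f (a :: l))

lemma pathMean_comm (m n : ℕ) (f : List (Bool × Bool) → List (Bool × Bool) → ℝ) :
    pathMean m (fun l => pathMean n (fun l' => f l l')) =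
      pathMean n (fun l' => pathMean m (fun l => f l l')) := by
  induction m generalizing f with
  | zero => rfl
  | succ m ih => simp only [pathMean, ih, pathMean_div_const, pathMean_sum]

/-- The total displacement of a list of planar steps. -/
def pos (l : List (Bool × Bool)) : ℤ × ℤ := (l.map dvec).sum

@[simp] lemma pos_nil : pos [] = 0 := rfl

@[simp] lemma pos_cons (a : Bool × Bool) (l : List (Bool × Bool)) :
    pos (a :: l) = dvec a + pos l := by simp [pos]

@[simp] lemma pos_append (l l' : List (Bool × Bool)) : pos (l ++ l') = pos l + pos l' := by
  simp [pos]

lemma pos_reverse (l : List (Bool × Bool)) : pos l.reverse = pos l := by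
  induction l with
  | nil => rfl
  | cons a l ih => simp [ih, add_comm]

/-- The transition probabilities of the simple random walk on `ℤ`. -/
noncomputable def lineProb : ℕ → ℤ → ℝ
  | 0, x => if x = 0 then 1 else 0
  | k + 1, x => (lineProb k (x - 1) + lineProb k (x + 1)) / 2

/-- The transition probabilities of the planar walk. -/
noncomputable def planeProb (k : ℕ) (v : ℤ × ℤ) : ℝ := lineProb k v.1 * lineProb k v.2

lemma planeProb_succ (k : ℕ) (v : ℤ × ℤ) :
    planeProb (k + 1) v = (∑ a, planeProb k (v - dvec a)) / 4 := by
  simp only [planeProb, lineProb, Fintype.sum_prod_type, Fintype.sum_bool, dvec, sgn]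
  simp
  ring

lemma pathMean_pos_eq (k : ℕ) (v : ℤ × ℤ) :
    pathMean k (fun l => if pos l = v then 1 else 0) = planeProb k v := by
  induction k generalizing v with
  | zero =>
    obtain ⟨x, y⟩ := v
    by_cases hx : x = 0 <;> by_cases hy : y = 0 <;>
      simp [pathMean, planeProb, lineProb, hx, hy, Prod.ext_iff, eq_comm]
  | succ k ih =>
    rw [planeProb_succ]
    simp only [pathMean, ← ih, pos_cons, eq_sub_iff_add_eq']

lemma lineProb_nonneg (k : ℕ) (x : ℤ) : 0 ≤ lineProb k x := by
  induction k generalizing x with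
  | zero => simp only [lineProb]; split_ifs <;> norm_num
  | succ k ih => have := ih (x - 1); have := ih (x + 1); simp only [lineProb]; linarith

lemma planeProb_nonneg (k : ℕ) (v : ℤ × ℤ) : 0 ≤ planeProb k v :=
  mul_nonneg (lineProb_nonneg _ _) (lineProb_nonneg _ _)

lemma lineProb_eq_zero {k : ℕ} {x : ℤ} (h : ∀ j : ℕ, x ≠ 2 * j - k) : lineProb k x = 0 := by
  induction k generalizing x with
  | zero => have := h 0; simp_all [lineProb]
  | succ k ih =>
    simp only [lineProb]
    rw [ih, ih]
    · simp
    · intro j hj; apply h j; push_cast; linarith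
    · intro j hj; apply h (j + 1); push_cast; linarith

lemma lineProb_eq_choose (k j : ℕ) : lineProb k (2 * j - k) = k.choose j / 2 ^ k := by
  induction k generalizing j with
  | zero => cases j <;> simp [lineProb]; intro h; omega
  | succ k ih =>
    cases j with
    | zero =>
      simp only [lineProb]
      rw [lineProb_eq_zero (x := _ - 1) (by intro j; push_cast; omega)]
      have := ih 0
      simp only [Nat.choose_zero_right] at this ⊢
      rw [show (2 * ((0 : ℕ) : ℤ) - ((k + 1 : ℕ) : ℤ) + 1) = 2 * ((0 : ℕ) : ℤ) - k by push_cast; ring,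
        this, pow_succ]
      simp
      ring
    | succ j =>
      simp only [lineProb]
      rw [show (2 * ((j + 1 : ℕ) : ℤ) - ((k + 1 : ℕ) : ℤ) - 1) = 2 * (j : ℤ) - k by push_cast; ring,
        show (2 * ((j + 1 : ℕ) : ℤ) - ((k + 1 : ℕ) : ℤ) + 1) = 2 * ((j + 1 : ℕ) : ℤ) - k by
          push_cast; ring, ih, ih, Nat.choose_succ_succ, pow_succ]
      push_cast
      ring

lemma centralBinom_sq_mul_le (j : ℕ) :
    ((j.centralBinom : ℝ) / 4 ^ j) ^ 2 * (2 * j + 1) ≤ 1 := by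
  induction j with
  | zero => simp
  | succ j ih =>
    have h : ((j + 1).centralBinom : ℝ) / 4 ^ (j + 1) =
        (j.centralBinom / 4 ^ j) * ((2 * j + 1) / (2 * (j + 1))) := by
      have := Nat.succ_mul_centralBinom_succ j
      have h' : ((j : ℝ) + 1) * (j + 1).centralBinom = 2 * (2 * j + 1) * j.centralBinom := by
        exact_mod_cast this
      rw [pow_succ]
      field_simp
      linarith
    rw [h, mul_pow]
    refine le_trans ?_ ih
    rw [mul_assoc]
    refine mul_le_mul_of_nonneg_left ?_ (sq_nonneg _)
    rw [div_pow, div_mul_eq_mul_div, div_le_iff₀ (by positivity)]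
    push_cast
    nlinarith [(Nat.cast_nonneg j : (0 : ℝ) ≤ j)]

lemma le_centralBinom_sq_mul (j : ℕ) (hj : 1 ≤ j) :
    1 ≤ ((j.centralBinom : ℝ) / 4 ^ j) ^ 2 * (4 * j) := by
  induction j, hj using Nat.le_induction with
  | base => norm_num [Nat.centralBinom, Nat.choose]
  | succ j hj ih =>
    have h : ((j + 1).centralBinom : ℝ) / 4 ^ (j + 1) =
        (j.centralBinom / 4 ^ j) * ((2 * j + 1) / (2 * (j + 1))) := by
      have := Nat.succ_mul_centralBinom_succ j
      have h' : ((j : ℝ) + 1) * (j + 1).centralBinom = 2 * (2 * j + 1) * j.centralBinom := by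
        exact_mod_cast this
      rw [pow_succ]
      field_simp
      linarith
    rw [h, mul_pow]
    refine le_trans ih ?_
    rw [mul_assoc]
    refine mul_le_mul_of_nonneg_left ?_ (sq_nonneg _)
    rw [div_pow, div_mul_eq_mul_div, le_div_iff₀ (by positivity)]
    push_cast
    nlinarith [(Nat.cast_nonneg j : (0 : ℝ) ≤ j)]

lemma lineProb_even_sq_le (j : ℕ) (x : ℤ) : lineProb (2 * j) x ^ 2 * (2 * j + 1) ≤ 1 := by
  by_cases h : ∃ i : ℕ, x = 2 * i - ((2 * j : ℕ) : ℤ)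
  · obtain ⟨i, rfl⟩ := h
    rw [lineProb_eq_choose]
    refine le_trans ?_ (centralBinom_sq_mul_le j)
    have : ((2 * j).choose i : ℝ) ≤ j.centralBinom := by
      exact_mod_cast Nat.choose_le_centralBinom i j
    rw [pow_mul]
    norm_num
    gcongr
  · push Not at h
    rw [lineProb_eq_zero h]
    simp

lemma lineProb_sq_le {k : ℕ} (hk : 1 ≤ k) (x : ℤ) : lineProb k x ^ 2 * k ≤ 1 := by
  rcases Nat.even_or_odd' k with ⟨j, rfl | rfl⟩
  · have := lineProb_even_sq_le j x
    push_cast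
    nlinarith [sq_nonneg (lineProb (2 * j) x)]
  · have h1 := lineProb_even_sq_le j (x - 1)
    have h2 := lineProb_even_sq_le j (x + 1)
    simp only [lineProb]
    push_cast
    have : ((lineProb (2 * j) (x - 1) + lineProb (2 * j) (x + 1)) / 2) ^ 2 ≤
        (lineProb (2 * j) (x - 1) ^ 2 + lineProb (2 * j) (x + 1) ^ 2) / 2 := by
      nlinarith [sq_nonneg (lineProb (2 * j) (x - 1) - lineProb (2 * j) (x + 1))]
    have hj : (0 : ℝ) ≤ 2 * j + 1 := by positivity
    nlinarith

lemma planeProb_le {k : ℕ} (hk : 1 ≤ k) (v : ℤ × ℤ) : planeProb k v ≤ 1 / k := by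
  have h1 := lineProb_sq_le hk v.1
  have h2 := lineProb_sq_le hk v.2
  have hk' : (0 : ℝ) < k := by exact_mod_cast hk
  rw [le_div_iff₀ hk', planeProb]
  nlinarith [sq_nonneg (lineProb k v.1 - lineProb k v.2)]

lemma planeProb_zero_ge {j : ℕ} (hj : 1 ≤ j) : 1 / (4 * j) ≤ planeProb (2 * j) 0 := by
  have h := le_centralBinom_sq_mul j hj
  have hj' : (0 : ℝ) < j := by exact_mod_cast hj
  have h0 := lineProb_eq_choose (2 * j) j
  rw [pow_mul] at h0
  norm_num at h0
  rw [div_le_iff₀ (by positivity)]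
  simp only [planeProb, Prod.fst_zero, Prod.snd_zero, h0]
  rw [Nat.centralBinom] at h
  linarith [h]

/-- The set of points visited by the path started at `y` with the given steps. -/
def vis : ℤ × ℤ → List (Bool × Bool) → Finset (ℤ × ℤ)
  | y, [] => {y}
  | y, a :: l => insert y (vis (y + dvec a) l)

lemma mem_vis_self (y : ℤ × ℤ) (l : List (Bool × Bool)) : y ∈ vis y l := by
  cases l <;> simp [vis]

lemma vis_translate (y c : ℤ × ℤ) (l : List (Bool × Bool)) :
    vis (y + c) l = (vis y l).image (· + c) := by
  induction l generalizing y with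
  | nil => simp [vis]
  | cons a l ih => simp only [vis, Finset.image_insert, ← ih, add_right_comm]

lemma card_vis (y : ℤ × ℤ) (l : List (Bool × Bool)) : (vis y l).card = (vis 0 l).card := by
  have := vis_translate 0 y l
  rw [zero_add] at this
  rw [this, Finset.card_image_of_injective _ (add_left_injective y)]

lemma vis_append (y : ℤ × ℤ) (l l' : List (Bool × Bool)) :
    vis y (l ++ l') = vis y l ∪ vis (y + pos l) l' := by
  induction l generalizing y with
  | nil => simp [vis, mem_vis_self]
  | cons a l ih => simp [vis, ih, add_assoc]

lemma vis_neg_pos (l : List (Bool × Bool)) :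
    vis (-pos l) l = (vis 0 l.reverse).image (fun x => -x) := by
  induction l with
  | nil => simp [vis]
  | cons a l ih =>
    have h : -pos (a :: l) + dvec a = -pos l := by simp
    simp only [vis, h, ih, List.reverse_cons, vis_append, Finset.image_union, pos_reverse, zero_add,
      Finset.image_insert, Finset.image_singleton]
    have h0 : -pos l ∈ (vis 0 l.reverse).image (fun x => -x) := by
      rw [← ih]; exact mem_vis_self _ _
    ext x
    simp only [Finset.mem_insert, Finset.mem_union, Finset.mem_singleton, pos_cons,
      add_comm (dvec a)]
    constructor
    · rintro (h | h)
      · right; right; exact h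
      · left; exact h
    · rintro (h | h | h)
      · right; exact h
      · right; rw [h]; exact h0
      · left; exact h

/-- The truncated Green function of the planar walk at the origin. -/
noncomputable def green (N : ℕ) : ℝ := ∑ k ∈ Finset.range N, planeProb k 0

lemma hitProb_mul_green_le (n N : ℕ) (x y : ℤ × ℤ) :
    pathMean n (fun l => if x ∈ vis y l then 1 else 0) * green N ≤
      ∑ k ∈ Finset.range (n + N), planeProb k (x - y) := by
  induction n generalizing y with
  | zero =>
    by_cases h : x = y
    · subst h; simp [pathMean, vis, green]
    · simp only [pathMean, vis, Finset.mem_singleton, h, if_false, zero_mul]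
      exact Finset.sum_nonneg fun _ _ => planeProb_nonneg _ _
  | succ n ih =>
    by_cases h : x = y
    · subst h
      simp only [mem_vis_self, if_true, pathMean_const, one_mul, sub_self, green]
      exact Finset.sum_le_sum_of_subset_of_nonneg
        (Finset.range_mono (by omega)) fun _ _ _ => planeProb_nonneg _ _
    · have h1 : n + 1 + N = (n + N) + 1 := by ring
      rw [h1, Finset.sum_range_succ']
      simp only [pathMean, vis, Finset.mem_insert, h, false_or, planeProb_succ]
      rw [← Finset.sum_div, Finset.sum_comm, div_mul_eq_mul_div, Finset.sum_mul]
      refine le_trans ?_ (le_add_of_nonneg_right (planeProb_nonneg _ _))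
      gcongr with a
      simpa [sub_sub] using ih (y + dvec a)

lemma sum_planeProb_le_one (k : ℕ) (A : Finset (ℤ × ℤ)) (y : ℤ × ℤ) :
    ∑ x ∈ A, planeProb k (x - y) ≤ 1 := by
  simp only [← pathMean_pos_eq, ← pathMean_sum]
  refine pathMean_le_const fun l _ => ?_
  simp only [eq_sub_iff_add_eq]
  rw [Finset.sum_ite_eq]
  split_ifs <;> norm_num

lemma sum_planeProb_le_div {k : ℕ} (hk : 1 ≤ k) (A : Finset (ℤ × ℤ)) (y : ℤ × ℤ) :
    ∑ x ∈ A, planeProb k (x - y) ≤ A.card / k := by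
  calc ∑ x ∈ A, planeProb k (x - y) ≤ ∑ x ∈ A, (1 / k : ℝ) :=
        Finset.sum_le_sum fun _ _ => planeProb_le hk _
    _ = A.card / k := by simp [div_eq_mul_inv]

lemma sum_le_of_le_one_of_le_div {g : ℕ → ℝ} {a : ℕ} (ha : 1 ≤ a) (h1 : ∀ k, g k ≤ 1)
    (h2 : ∀ k, 1 ≤ k → g k ≤ a / k) {M : ℕ} (hM : a ≤ M) :
    ∑ k ∈ Finset.range (M + 1), g k ≤ a + 1 + a * Real.log (M / a) := by
  have ha' : (0 : ℝ) < a := by exact_mod_cast ha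
  induction M, hM using Nat.le_induction with
  | base =>
    rw [div_self ha'.ne', Real.log_one, mul_zero, add_zero]
    refine (Finset.sum_le_sum fun k _ => h1 k).trans ?_
    simp
  | succ M hM ih =>
    have hM' : (0 : ℝ) < M := by exact_mod_cast (by omega : 0 < M)
    rw [Finset.sum_range_succ]
    have hg := h2 (M + 1) (by omega)
    have hl : (1 : ℝ) / (M + 1) ≤ Real.log ((M + 1) / M) := by
      have := Real.one_sub_inv_le_log_of_pos (x := ((M : ℝ) + 1) / M) (by positivity)
      refine le_trans (le_of_eq ?_) this
      field_simp
      ring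
    have h3 : Real.log (((M + 1 : ℕ) : ℝ) / a) =
        Real.log (M / a) + Real.log ((M + 1) / M) := by
      rw [← Real.log_mul (by positivity) (by positivity)]
      congr 1
      push_cast
      field_simp
    rw [h3]
    have h4 : (a : ℝ) / ((M + 1 : ℕ) : ℝ) ≤ a * Real.log ((M + 1) / M) := by
      rw [div_eq_mul_one_div]
      push_cast
      gcongr
    linarith

lemma card_inter_eq_sum (A : Finset (ℤ × ℤ)) (y : ℤ × ℤ) (l : List (Bool × Bool)) :
    ((A ∩ vis y l).card : ℝ) = ∑ x ∈ A, if x ∈ vis y l then 1 else 0 := by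
  rw [← Finset.filter_mem_eq_inter, Finset.card_filter]
  push_cast
  rfl

lemma pathMean_hits_mul_green_le (n N : ℕ) (A : Finset (ℤ × ℤ)) (y : ℤ × ℤ) (hA : 1 ≤ A.card)
    {M : ℕ} (hAM : A.card ≤ M) (hM : n + N ≤ M + 1) :
    pathMean n (fun l => ((A ∩ vis y l).card : ℝ)) * green N ≤
      A.card + 1 + A.card * Real.log (M / A.card) := by
  simp only [card_inter_eq_sum, pathMean_sum, Finset.sum_mul]
  calc _ ≤ ∑ x ∈ A, ∑ k ∈ Finset.range (M + 1), planeProb k (x - y) := by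
        refine Finset.sum_le_sum fun x _ => (hitProb_mul_green_le n N x y).trans ?_
        exact Finset.sum_le_sum_of_subset_of_nonneg
          (Finset.range_mono hM) fun _ _ _ => planeProb_nonneg _ _
    _ = ∑ k ∈ Finset.range (M + 1), ∑ x ∈ A, planeProb k (x - y) := Finset.sum_comm
    _ ≤ _ := sum_le_of_le_one_of_le_div hA (fun k => sum_planeProb_le_one k A y)
        (fun k hk => sum_planeProb_le_div hk A y) hAM

lemma card_inter_insert_of_mem {A : Finset (ℤ × ℤ)} {y : ℤ × ℤ} (hy : y ∈ A)
    (V : Finset (ℤ × ℤ)) : (A ∩ insert y V).card = ((A.erase y) ∩ V).card + 1 := by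
  have : A ∩ insert y V = insert y ((A.erase y) ∩ V) := by
    ext x
    simp only [Finset.mem_inter, Finset.mem_insert, Finset.mem_erase]
    by_cases h : x = y
    · simp [h, hy]
    · simp [h]
  rw [this, Finset.card_insert_of_notMem (by simp)]

lemma pathMean_hits_add_le {m : ℕ} (hm : 1 ≤ m) (μ : ℝ) (n : ℕ) (A : Finset (ℤ × ℤ))
    (y : ℤ × ℤ) (M : ℕ)
    (hμ : ∀ n' ≤ n, ∀ y, pathMean n' (fun l => ((A ∩ vis y l).card : ℝ)) ≤ μ) :
    pathMean n (fun l => if M + m ≤ (A ∩ vis y l).card then 1 else 0) ≤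
      μ / m * pathMean n (fun l => if M ≤ (A ∩ vis y l).card then 1 else 0) := by
  have hm' : (0 : ℝ) < m := by exact_mod_cast hm
  have hμ0 : 0 ≤ μ :=
    (pathMean_nonneg fun l _ => Nat.cast_nonneg _).trans (hμ n le_rfl y)
  induction n generalizing A y M with
  | zero =>
    rcases Nat.eq_zero_or_pos M with rfl | hM
    · simp only [zero_add, Nat.zero_le, if_true, pathMean, mul_one]
      have := hμ 0 le_rfl y
      simp only [pathMean] at this
      rw [le_div_iff₀ hm']
      split_ifs with h
      · rw [one_mul]; exact le_trans (by exact_mod_cast h) this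
      · rw [zero_mul]; exact hμ0
    · have : ¬ (M + m ≤ (A ∩ vis y []).card) := by
        have : (A ∩ vis y []).card ≤ ({y} : Finset (ℤ × ℤ)).card :=
          Finset.card_le_card Finset.inter_subset_right
        simp at this
        omega
      simp only [pathMean, this, if_false]
      split_ifs <;> simp; positivity
  | succ n ih =>
    rcases Nat.eq_zero_or_pos M with rfl | hM
    · simp only [zero_add, Nat.zero_le, if_true, pathMean_const, mul_one]
      rw [le_div_iff₀ hm', ← pathMean_mul_const]
      refine le_trans (pathMean_mono fun l _ => ?_) (hμ _ le_rfl y)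
      split_ifs with h
      · rw [one_mul]; exact_mod_cast h
      · simp
    · obtain ⟨M, rfl⟩ : ∃ M', M = M' + 1 := ⟨M - 1, by omega⟩
      simp only [pathMean, vis]
      rw [mul_div_assoc', Finset.mul_sum]
      gcongr with a
      by_cases hy : y ∈ A
      · simp only [card_inter_insert_of_mem hy]
        have := ih (A.erase y) (y + dvec a) M fun n' hn' z =>
          (pathMean_mono fun l _ => Nat.cast_le.mpr (Finset.card_le_card
            (Finset.inter_subset_inter_right (Finset.erase_subset _ _)))).trans
            (hμ n' (by omega) z)
        simpa only [add_le_add_iff_right, add_right_comm M 1 m] using this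
      · simp only [Finset.inter_insert_of_notMem hy]
        exact ih A (y + dvec a) (M + 1) fun n' hn' z => hμ n' (by omega) z

lemma pathMean_hits_mul_le {m : ℕ} (hm : 1 ≤ m) (μ : ℝ) (n : ℕ) (A : Finset (ℤ × ℤ))
    (y : ℤ × ℤ) (p : ℕ)
    (hμ : ∀ n' ≤ n, ∀ y, pathMean n' (fun l => ((A ∩ vis y l).card : ℝ)) ≤ μ) :
    pathMean n (fun l => if p * m ≤ (A ∩ vis y l).card then 1 else 0) ≤ (μ / m) ^ p := by
  have hμ0 : 0 ≤ μ :=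
    (pathMean_nonneg fun l _ => Nat.cast_nonneg _).trans (hμ n le_rfl y)
  induction p with
  | zero => simp [pathMean_const]
  | succ p ih =>
    rw [Nat.succ_mul, pow_succ']
    exact (pathMean_hits_add_le hm μ n A y (p * m) hμ).trans
      (mul_le_mul_of_nonneg_left ih (by positivity))

/-- The number of visits to `x` by the path started at `y`. -/
def visitCount (x : ℤ × ℤ) : ℤ × ℤ → List (Bool × Bool) → ℕ
  | y, [] => if x = y then 1 else 0
  | y, a :: l => (if x = y then 1 else 0) + visitCount x (y + dvec a) l

/-- The number of pairs of distinct times at which the path is at the same point. -/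
def selfInt : List (Bool × Bool) → ℕ
  | [] => 0
  | a :: l => selfInt l + visitCount 0 (dvec a) l

lemma visitCount_translate (x y c : ℤ × ℤ) (l : List (Bool × Bool)) :
    visitCount (x + c) (y + c) l = visitCount x y l := by
  induction l generalizing y with
  | nil => simp [visitCount]
  | cons a l ih => simp [visitCount, add_right_comm y c, ih]

lemma visitCount_eq_zero {x y : ℤ × ℤ} {l : List (Bool × Bool)} (h : x ∉ vis y l) :
    visitCount x y l = 0 := by
  induction l generalizing y with
  | nil => simpa [visitCount, vis] using h
  | cons a l ih =>
    simp only [vis, Finset.mem_insert, not_or] at h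
    simp [visitCount, h.1, ih h.2]

lemma sum_visitCount (y : ℤ × ℤ) (l : List (Bool × Bool)) :
    ∑ x ∈ vis y l, visitCount x y l = l.length + 1 := by
  induction l generalizing y with
  | nil => simp [visitCount, vis]
  | cons a l ih =>
    simp only [visitCount, vis, Finset.sum_add_distrib]
    rw [← Finset.sum_subset (Finset.subset_insert y (vis (y + dvec a) l))
      (fun x _ hx => visitCount_eq_zero hx), ih]
    simp
    ring

lemma sum_visitCount_sq (y : ℤ × ℤ) (l : List (Bool × Bool)) :
    ∑ x ∈ vis y l, visitCount x y l ^ 2 = l.length + 1 + 2 * selfInt l := by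
  induction l generalizing y with
  | nil => simp [visitCount, vis, selfInt]
  | cons a l ih =>
    have h1 : ∀ x, ((if x = y then 1 else 0) + visitCount x (y + dvec a) l) ^ 2 =
        visitCount x (y + dvec a) l ^ 2 +
          if x = y then 2 * visitCount y (y + dvec a) l + 1 else 0 := by
      intro x
      split_ifs with h
      · subst h; ring
      · ring
    simp only [visitCount, vis, selfInt, h1, Finset.sum_add_distrib]
    rw [← Finset.sum_subset (Finset.subset_insert y (vis (y + dvec a) l))
      (fun x _ hx => by rw [visitCount_eq_zero hx]; rfl), ih]
    have h2 : visitCount y (y + dvec a) l = visitCount 0 (dvec a) l := by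
      have := visitCount_translate 0 (dvec a) y l
      rwa [zero_add, add_comm] at this
    simp [h2]
    ring

lemma sq_le_card_vis_mul (y : ℤ × ℤ) (l : List (Bool × Bool)) :
    (l.length + 1) ^ 2 ≤ (vis y l).card * (l.length + 1 + 2 * selfInt l) := by
  rw [← sum_visitCount_sq y l, ← sum_visitCount y l]
  exact sq_sum_le_card_mul_sum_sq

lemma pathMean_visitCount (n : ℕ) (x y : ℤ × ℤ) :
    pathMean n (fun l => (visitCount x y l : ℝ)) =
      ∑ k ∈ Finset.range (n + 1), planeProb k (x - y) := by
  have h0 : planeProb 0 (x - y) = if x = y then 1 else 0 := by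
    rw [← pathMean_pos_eq]
    simp [pathMean, eq_comm (a := (0 : ℤ × ℤ)), sub_eq_zero]
  induction n generalizing y with
  | zero => simp [pathMean, visitCount, h0]
  | succ n ih =>
    rw [Finset.sum_range_succ', h0]
    simp only [pathMean, visitCount, planeProb_succ]
    rw [← Finset.sum_div, Finset.sum_comm]
    push_cast
    simp only [pathMean_add, pathMean_const, Finset.sum_add_distrib]
    rw [add_div, add_comm]
    congr 1
    · congr 1
      refine Finset.sum_congr rfl fun a _ => ?_
      rw [ih, sub_sub]
      rw [← pathMean_pos_eq]
      simp [pathMean, eq_comm (a := (0 : ℤ × ℤ)), sub_eq_zero]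
    · split_ifs <;> simp

lemma pathMean_selfInt_le (n : ℕ) :
    pathMean n (fun l => (selfInt l : ℝ)) ≤ n * (1 + Real.log n) := by
  have key : pathMean n (fun l => (selfInt l : ℝ)) ≤ n * harmonic n := by
    induction n with
    | zero => simp [pathMean, selfInt]
    | succ n ih =>
      simp only [pathMean, selfInt]
      push_cast
      simp only [pathMean_add, pathMean_visitCount, Finset.sum_add_distrib]
      have h1 : (∑ a, ∑ k ∈ Finset.range (n + 1), planeProb k (0 - dvec a)) / 4 ≤
          ∑ k ∈ Finset.range (n + 1), ((k : ℝ) + 1)⁻¹ := by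
        rw [Finset.sum_comm, Finset.sum_div]
        refine Finset.sum_le_sum fun k _ => ?_
        rw [← planeProb_succ]
        have := planeProb_le (k := k + 1) (by omega) 0
        simpa using this
      have h2 : ((harmonic (n + 1) : ℚ) : ℝ) =
          ∑ k ∈ Finset.range (n + 1), ((k : ℝ) + 1)⁻¹ := by
        simp [harmonic]
      have h3 : ((harmonic n : ℚ) : ℝ) ≤ (harmonic (n + 1) : ℚ) := by
        rw [harmonic_succ]; push_cast
        have : (0 : ℝ) ≤ ((n : ℝ) + 1)⁻¹ := by positivity
        linarith
      have h4 : (n : ℝ) * (harmonic n : ℚ) ≤ n * (harmonic (n + 1) : ℚ) := by gcongr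
      rw [← h2] at h1
      rw [add_div]
      have h6 : (∑ _a : Bool × Bool, pathMean n (fun l => (selfInt l : ℝ))) / 4 =
          pathMean n (fun l => (selfInt l : ℝ)) := by simp
      rw [h6]
      linarith
  exact key.trans (mul_le_mul_of_nonneg_left (harmonic_le_one_add_log n) (by positivity))

lemma pathMean_card_vis_lt_le (n r : ℕ) :
    pathMean n (fun l => if (vis 0 l).card < r then 1 else 0) ≤
      r * (3 + 2 * Real.log n) / (n + 1) := by
  have hn : (0 : ℝ) < (n : ℝ) + 1 := by positivity
  have hstep : pathMean n (fun l => if (vis 0 l).card < r then 1 else 0) ≤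
      pathMean n (fun l => r / (n + 1) ^ 2 * ((n + 1) + 2 * (selfInt l : ℝ))) := by
    refine pathMean_mono fun l hl => ?_
    have h := sq_le_card_vis_mul 0 l
    rw [hl] at h
    have h' : ((n : ℝ) + 1) ^ 2 ≤ (vis 0 l).card * ((n : ℝ) + 1 + 2 * selfInt l) := by
      exact_mod_cast h
    split_ifs with hr
    · rw [div_mul_eq_mul_div, le_div_iff₀ (by positivity), one_mul]
      refine h'.trans ?_
      gcongr
    · positivity
  refine hstep.trans ?_
  rw [pathMean_const_mul, pathMean_add, pathMean_const, pathMean_const_mul]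
  have h := pathMean_selfInt_le n
  have hlog : 0 ≤ Real.log n := Real.log_natCast_nonneg n
  rw [div_mul_eq_mul_div, div_le_div_iff₀ (by positivity) hn]
  have h5 : (n : ℝ) + 1 + 2 * pathMean n (fun l => (selfInt l : ℝ)) ≤
      (3 + 2 * Real.log n) * (n + 1) := by nlinarith [(Nat.cast_nonneg n : (0 : ℝ) ≤ n)]
  calc _ ≤ (r : ℝ) * ((3 + 2 * Real.log n) * (n + 1)) * (n + 1) := by gcongr
    _ = _ := by ring

lemma pathMean_card_vis_lt_pow (t r b : ℕ) :
    pathMean (b * t) (fun l => if (vis 0 l).card < r then 1 else 0) ≤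
      pathMean t (fun l => if (vis 0 l).card < r then 1 else 0) ^ b := by
  induction b with
  | zero => simp only [pow_zero]; exact pathMean_le_const fun l _ => by split_ifs <;> norm_num
  | succ b ih =>
    rw [show (b + 1) * t = t + b * t by ring, pathMean_append, pow_succ', ← pathMean_mul_const]
    refine pathMean_mono fun l _ => ?_
    refine le_trans ?_ (mul_le_mul_of_nonneg_left ih (by split_ifs <;> norm_num))
    rw [← pathMean_const_mul]
    refine pathMean_mono fun l' _ => ?_
    have h1 : (vis 0 l).card ≤ (vis 0 (l ++ l')).card := by
      rw [vis_append]; exact Finset.card_le_card Finset.subset_union_left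
    have h2 : (vis 0 l').card ≤ (vis 0 (l ++ l')).card := by
      rw [vis_append, ← card_vis (0 + pos l)]; exact Finset.card_le_card Finset.subset_union_right
    split_ifs <;> first | omega | norm_num

lemma green_ge (N : ℕ) (hN : 4 ≤ N) : Real.log N / 8 ≤ green (N + 1) := by
  have h1 : ∑ j ∈ Finset.range (N / 2), (1 / (4 * ((j : ℝ) + 1))) ≤ green (N + 1) := by
    calc _ ≤ ∑ j ∈ Finset.range (N / 2), planeProb (2 * (j + 1)) 0 := by
          refine Finset.sum_le_sum fun j _ => ?_
          have := planeProb_zero_ge (j := j + 1) (by omega)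
          push_cast at this
          exact this
      _ = ∑ k ∈ (Finset.range (N / 2)).image (fun j => 2 * (j + 1)), planeProb k 0 := by
          rw [Finset.sum_image]; intro a _ b _ h; simp at h; exact h
      _ ≤ _ := by
          refine Finset.sum_le_sum_of_subset_of_nonneg ?_ fun _ _ _ => planeProb_nonneg _ _
          intro k hk
          simp only [Finset.mem_image, Finset.mem_range] at hk ⊢
          omega
  refine le_trans ?_ h1
  have h2 := log_add_one_le_harmonic (N / 2)
  have h3 : ((harmonic (N / 2) : ℚ) : ℝ) = ∑ j ∈ Finset.range (N / 2), ((j : ℝ) + 1)⁻¹ := by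
    simp [harmonic]
  rw [h3] at h2
  push_cast at h2
  have h4 : ∑ j ∈ Finset.range (N / 2), (1 / (4 * ((j : ℝ) + 1))) =
      (∑ j ∈ Finset.range (N / 2), ((j : ℝ) + 1)⁻¹) / 4 := by
    rw [Finset.sum_div]
    refine Finset.sum_congr rfl fun j _ => ?_
    field_simp
  rw [h4]
  have h5 : Real.log N ≤ 2 * Real.log ((N / 2 : ℕ) + 1) := by
    have : 2 * Real.log ((N / 2 : ℕ) + 1) = Real.log ((((N / 2 : ℕ) : ℝ) + 1) ^ 2) := by
      rw [Real.log_pow]; norm_num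
    rw [this]
    apply Real.log_le_log (by positivity)
    have h6 : (N : ℝ) ≤ 2 * ((N / 2 : ℕ) : ℝ) + 1 := by
      exact_mod_cast (by omega : N ≤ 2 * (N / 2) + 1)
    nlinarith [sq_nonneg (((N / 2 : ℕ) : ℝ))]
  linarith

/-- The probability that the walk, run for at most `R` steps from the site `(p, z)` with set of
visited sites `A` and prescribed planar steps `l`, is at `x` when it needs a further planar step. -/
noncomputable def val (x : (ℤ × ℤ) × ℤ) :
    ℕ → Finset ((ℤ × ℤ) × ℤ) → ℤ × ℤ → ℤ → List (Bool × Bool) → ℝ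
  | 0, _, _, _, _ => 0
  | R + 1, A, p, z, l =>
    if (p, z) ∈ A then
      match l with
      | [] => if (p, z) = x then 1 else 0
      | a :: l' => val x R A (p + dvec a) z l'
    else (val x R (insert (p, z) A) p (z + 1) l + val x R (insert (p, z) A) p (z - 1) l) / 2

section val
variable {x : (ℤ × ℤ) × ℤ} {R : ℕ} {A : Finset ((ℤ × ℤ) × ℤ)} {p : ℤ × ℤ} {z : ℤ}
  {l : List (Bool × Bool)}

lemma val_old_nil (h : (p, z) ∈ A) :
    val x (R + 1) A p z [] = if (p, z) = x then 1 else 0 := by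
  simp [val, h]

lemma val_old_cons (h : (p, z) ∈ A) (a : Bool × Bool) :
    val x (R + 1) A p z (a :: l) = val x R A (p + dvec a) z l := by
  simp [val, h]

lemma val_new (h : (p, z) ∉ A) : val x (R + 1) A p z l =
    (val x R (insert (p, z) A) p (z + 1) l + val x R (insert (p, z) A) p (z - 1) l) / 2 := by
  simp [val, h]

lemma val_nonneg : 0 ≤ val x R A p z l := by
  induction R generalizing A p z l with
  | zero => simp [val]
  | succ R ih =>
    by_cases h : (p, z) ∈ A
    · cases l with
      | nil => rw [val_old_nil h]; split_ifs <;> norm_num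
      | cons a l => rw [val_old_cons h]; exact ih
    · rw [val_new h]; exact div_nonneg (add_nonneg ih ih) (by norm_num)

lemma val_le_one : val x R A p z l ≤ 1 := by
  induction R generalizing A p z l with
  | zero => simp [val]
  | succ R ih =>
    by_cases h : (p, z) ∈ A
    · cases l with
      | nil => rw [val_old_nil h]; split_ifs <;> norm_num
      | cons a l => rw [val_old_cons h]; exact ih
    · rw [val_new h]
      have h1 := @ih (insert (p, z) A) p (z + 1) l
      have h2 := @ih (insert (p, z) A) p (z - 1) l
      linarith

lemma val_eq_zero (hx : p + pos l ≠ x.1) : val x R A p z l = 0 := by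
  induction R generalizing A p z l with
  | zero => simp [val]
  | succ R ih =>
    by_cases h : (p, z) ∈ A
    · cases l with
      | nil =>
        rw [val_old_nil h, if_neg]
        rintro rfl
        simp at hx
      | cons a l => rw [val_old_cons h]; exact ih (by simpa [add_assoc] using hx)
    · rw [val_new h, ih hx, ih hx]; norm_num

end val

/-- The weight controlling the number of vertical steps. -/
noncomputable def weight (A : Finset ((ℤ × ℤ) × ℤ)) (p : ℤ × ℤ) (z : ℤ) : ℝ :=
  if (p, z) ∈ A then 1 else if (p, z + 1) ∈ A ∨ (p, z - 1) ∈ A then 2 else 8 / 3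

lemma one_le_weight (A : Finset ((ℤ × ℤ) × ℤ)) (p : ℤ × ℤ) (z : ℤ) : 1 ≤ weight A p z := by
  unfold weight; split_ifs <;> norm_num

lemma weight_le (A : Finset ((ℤ × ℤ) × ℤ)) (p : ℤ × ℤ) (z : ℤ) : weight A p z ≤ 8 / 3 := by
  unfold weight; split_ifs <;> norm_num

lemma weight_le_two {A : Finset ((ℤ × ℤ) × ℤ)} {p : ℤ × ℤ} {z : ℤ}
    (h : (p, z + 1) ∈ A ∨ (p, z - 1) ∈ A) : weight A p z ≤ 2 := by
  unfold weight; simp only [h, if_true]; split_ifs <;> norm_num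

lemma weight_new {A : Finset ((ℤ × ℤ) × ℤ)} {p : ℤ × ℤ} {z : ℤ} (h : (p, z) ∉ A) :
    4 / 3 * ((weight (insert (p, z) A) p (z + 1) + weight (insert (p, z) A) p (z - 1)) / 2) ≤
      weight A p z := by
  have h1 : weight (insert (p, z) A) p (z + 1) ≤ 2 := weight_le_two (by simp)
  have h2 : weight (insert (p, z) A) p (z - 1) ≤ 2 := weight_le_two (by simp)
  have h3 : (p, z + 1) ∈ A → weight (insert (p, z) A) p (z + 1) = 1 := fun h => by
    simp [weight, h]
  have h4 : (p, z - 1) ∈ A → weight (insert (p, z) A) p (z - 1) = 1 := fun h => by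
    simp [weight, h]
  conv_rhs => rw [weight, if_neg h]
  split_ifs with h5
  · rcases h5 with h5 | h5
    · rw [h3 h5]; linarith
    · rw [h4 h5]; linarith
  · linarith

/-- A supersolution for the probability that the walk makes `B` vertical steps, `d` of which are
already made, before it makes `j` more planar steps. -/
noncomputable def tail (B d : ℕ) (A : Finset ((ℤ × ℤ) × ℤ)) (p : ℤ × ℤ) (z : ℤ) (j : ℕ) : ℝ :=
  (4 / 3) ^ d / (4 / 3) ^ B * ((8 / 3) ^ j * weight A p z)

section tail
variable {B d : ℕ} {A : Finset ((ℤ × ℤ) × ℤ)} {p : ℤ × ℤ} {z : ℤ} {j : ℕ}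

lemma tail_nonneg : 0 ≤ tail B d A p z j := by
  have := one_le_weight A p z
  unfold tail; positivity

lemma one_le_tail (h : B ≤ d) : 1 ≤ tail B d A p z j := by
  have h1 : (1 : ℝ) ≤ (4 / 3) ^ d / (4 / 3) ^ B := by
    rw [le_div_iff₀ (by positivity), one_mul]
    exact pow_le_pow_right₀ (by norm_num) h
  have h2 : (1 : ℝ) ≤ (8 / 3) ^ j := one_le_pow₀ (by norm_num)
  have h3 := one_le_weight A p z
  unfold tail
  calc (1 : ℝ) = 1 * (1 * 1) := by norm_num
    _ ≤ _ := by gcongr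

lemma tail_zero_le : tail B 0 A p z j ≤ (8 / 3) ^ (j + 1) * (3 / 4) ^ B := by
  have h := weight_le A p z
  unfold tail
  rw [pow_zero, one_div, ← inv_pow, pow_succ, mul_comm]
  norm_num
  gcongr

lemma tail_old (h : (p, z) ∈ A) (q : ℤ × ℤ) : tail B d A q z j ≤ tail B d A p z (j + 1) := by
  have h1 : weight A p z = 1 := by simp [weight, h]
  have h2 := weight_le A q z
  unfold tail
  rw [h1, pow_succ, mul_one]
  gcongr

lemma tail_new (h : (p, z) ∉ A) :
    (tail B (d + 1) (insert (p, z) A) p (z + 1) j +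
      tail B (d + 1) (insert (p, z) A) p (z - 1) j) / 2 ≤ tail B d A p z j := by
  have := weight_new h
  unfold tail
  calc _ = (4 / 3) ^ d / (4 / 3) ^ B * ((8 / 3) ^ j * (4 / 3 *
      ((weight (insert (p, z) A) p (z + 1) + weight (insert (p, z) A) p (z - 1)) / 2))) := by
        rw [pow_succ]; ring
    _ ≤ _ := by gcongr

end tail

lemma exp_abs_step (c : ℝ) {y : ℤ} (hy : y ≠ 0) :
    (Real.exp (-(c * |(y + 1 : ℤ)|)) + Real.exp (-(c * |(y - 1 : ℤ)|))) / 2 =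
      Real.cosh c * Real.exp (-(c * |y|)) := by
  have key : ∀ u : ℝ, (Real.exp (-(c * (u + 1))) + Real.exp (-(c * (u - 1)))) / 2 =
      Real.cosh c * Real.exp (-(c * u)) := by
    intro u
    rw [Real.cosh_eq, div_mul_eq_mul_div, add_mul, ← Real.exp_add, ← Real.exp_add]
    ring_nf
  rcases lt_or_gt_of_ne hy with h | h
  · rw [abs_of_nonpos (by omega : y + 1 ≤ 0), abs_of_neg (by omega : y - 1 < 0), abs_of_neg h,
      ← key]
    push_cast
    ring_nf
  · rw [abs_of_pos (by omega : 0 < y + 1), abs_of_nonneg (by omega : 0 ≤ y - 1), abs_of_pos h,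
      ← key]
    push_cast
    ring_nf

lemma val_le_exp_add_tail (c : ℝ) (B d : ℕ) (x : (ℤ × ℤ) × ℤ) (R : ℕ)
    (A : Finset ((ℤ × ℤ) × ℤ)) (p : ℤ × ℤ) (z : ℤ) (l : List (Bool × Bool)) :
    val x R A p z l ≤ Real.cosh c ^ (B - d) * Real.exp (-(c * |z - x.2|)) +
      tail B d A p z l.length := by
  have hpos : ∀ (k : ℕ) (u : ℝ), 0 ≤ Real.cosh c ^ k * Real.exp u := fun k u => by
    have := Real.cosh_pos c
    positivity
  induction R generalizing A p z l d with
  | zero => exact add_nonneg (hpos _ _) tail_nonneg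
  | succ R ih =>
    rcases le_or_gt B d with hd | hd
    · exact val_le_one.trans ((one_le_tail hd).trans (le_add_of_nonneg_left (hpos _ _)))
    by_cases hz : z = x.2
    · refine val_le_one.trans (le_add_of_le_of_nonneg ?_ tail_nonneg)
      simp [hz, one_le_pow₀ (Real.one_le_cosh c)]
    by_cases h : (p, z) ∈ A
    · cases l with
      | nil =>
        rw [val_old_nil h, if_neg (by rintro rfl; exact hz rfl)]
        exact add_nonneg (hpos _ _) tail_nonneg
      | cons a l =>
        rw [val_old_cons h]
        exact (ih d A _ z l).trans (add_le_add_right (tail_old h _) _)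
    · rw [val_new h]
      have h1 := ih (d + 1) (insert (p, z) A) p (z + 1) l
      have h2 := ih (d + 1) (insert (p, z) A) p (z - 1) l
      have h3 := tail_new (B := B) (d := d) (j := l.length) h
      have h4 := exp_abs_step c (sub_ne_zero.mpr hz)
      rw [show z + 1 - x.2 = z - x.2 + 1 by ring] at h1
      rw [show z - 1 - x.2 = z - x.2 - 1 by ring] at h2
      rw [show B - d = B - (d + 1) + 1 by omega, pow_succ, mul_assoc, ← h4]
      push_cast at *
      linarith

/-- The number of steps of the path from `p` that start at a point outside `C` for the first
time. -/
def freshCount : Finset (ℤ × ℤ) → ℤ × ℤ → List (Bool × Bool) → ℕ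
  | _, _, [] => 0
  | C, p, a :: l => (if p ∈ C then 0 else 1) + freshCount (insert p C) (p + dvec a) l

/-- The union of `C` with the starting points of the steps of the path from `p`. -/
def colsAfter : Finset (ℤ × ℤ) → ℤ × ℤ → List (Bool × Bool) → Finset (ℤ × ℤ)
  | C, _, [] => C
  | C, p, a :: l => colsAfter (insert p C) (p + dvec a) l

lemma colsAfter_append (C : Finset (ℤ × ℤ)) (p : ℤ × ℤ) (l l' : List (Bool × Bool)) :
    colsAfter C p (l ++ l') = colsAfter (colsAfter C p l) (p + pos l) l' := by
  induction l generalizing C p with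
  | nil => simp [colsAfter]
  | cons a l ih => simp [colsAfter, ih, add_assoc]

lemma colsAfter_subset (C : Finset (ℤ × ℤ)) (p : ℤ × ℤ) (l : List (Bool × Bool)) :
    colsAfter C p l ⊆ C ∪ vis p l := by
  induction l generalizing C p with
  | nil => simp [colsAfter]
  | cons a l ih =>
    refine (ih _ _).trans ?_
    intro x
    simp only [vis, Finset.mem_union, Finset.mem_insert]
    tauto

lemma card_vis_sdiff_le (C : Finset (ℤ × ℤ)) (p : ℤ × ℤ) (l : List (Bool × Bool)) :
    (vis p l \ C).card ≤ freshCount C p l + 1 := by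
  induction l generalizing C p with
  | nil => exact (Finset.card_le_card Finset.sdiff_subset).trans (by simp [vis])
  | cons a l ih =>
    have h := ih (insert p C) (p + dvec a)
    simp only [vis, freshCount]
    by_cases hp : p ∈ C
    · rw [Finset.insert_sdiff_of_mem _ hp]
      rw [Finset.insert_eq_of_mem hp] at h ⊢
      simp only [hp, if_true]
      omega
    · rw [Finset.insert_sdiff_of_notMem _ hp]
      simp only [hp, if_false]
      have h2 : (insert p (vis (p + dvec a) l \ C)) ⊆
          insert p (vis (p + dvec a) l \ insert p C) := by
        intro x
        simp only [Finset.mem_insert, Finset.mem_sdiff]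
        tauto
      have h3 := (Finset.card_le_card h2).trans (Finset.card_insert_le _ _)
      omega

lemma freshCount_cons_le (C : Finset (ℤ × ℤ)) (p : ℤ × ℤ) (a : Bool × Bool)
    (l : List (Bool × Bool)) :
    freshCount C p (a :: l) ≤ 1 + freshCount (insert p C) p (a :: l) := by
  simp only [freshCount, Finset.mem_insert_self, if_true, Finset.insert_idem]
  split_ifs <;> omega

section window
variable {x : (ℤ × ℤ) × ℤ} {B : ℕ} {c e : ℝ}
  {l₂ : List (Bool × Bool)} {ρ : ℕ → ℤ → ℝ} {L N : ℕ}

lemma val_append_le_supersolution (hc : 0 ≤ c) (he : 0 ≤ e) {D : Finset (ℤ × ℤ)} {q : ℤ × ℤ}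
    (hnext : ∀ R (A : Finset ((ℤ × ℤ) × ℤ)) z, (∀ s ∈ A, s.1 ∈ D) →
      val x R A q z l₂ ≤ (if |z - x.2| ≤ L then c else 0) + e)
    (hρ0 : ∀ d y, 0 ≤ ρ d y)
    (hρ : ∀ d y, (ρ (d + 1) (y + 1) + ρ (d + 1) (y - 1)) / 2 ≤ ρ d y)
    (hρ1 : ∀ d (y : ℤ), N ≤ d → d < B → |y| ≤ (L : ℤ) → 1 ≤ ρ d y)
    (R : ℕ) (d : ℕ) (C : Finset (ℤ × ℤ)) (A : Finset ((ℤ × ℤ) × ℤ)) (p : ℤ × ℤ) (z : ℤ)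
    (l₁ : List (Bool × Bool)) (hA : ∀ s ∈ A, s.1 ∈ C) (hD : colsAfter C p l₁ = D)
    (hq : p + pos l₁ = q) (hN : N ≤ d + freshCount C p l₁) :
    val x R A p z (l₁ ++ l₂) ≤ c * (ρ d (z - x.2) + tail B d A p z l₁.length) + e := by
  induction R generalizing d C A p z l₁ with
  | zero =>
    have := hρ0 d (z - x.2)
    have := tail_nonneg (B := B) (d := d) (A := A) (p := p) (z := z) (j := l₁.length)
    simp only [val]
    positivity
  | succ R ih =>
    have h0 := hρ0 d (z - x.2)
    have h0' := tail_nonneg (B := B) (d := d) (A := A) (p := p) (z := z) (j := l₁.length)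
    cases l₁ with
    | nil =>
      simp only [pos_nil, add_zero] at hq
      subst hq
      simp only [colsAfter] at hD
      subst hD
      refine (hnext _ A z hA).trans (add_le_add_left ?_ e)
      split_ifs with hz
      · refine le_mul_of_one_le_right hc ?_
        rcases lt_or_ge d B with hd | hd
        · have := hρ1 d _ (by simpa [freshCount] using hN) hd hz
          linarith
        · have := one_le_tail (A := A) (p := p) (z := z) (j := 0) hd
          simp only [List.length_nil]
          linarith
      · positivity
    | cons a l =>
      by_cases h : (p, z) ∈ A
      · have hp : p ∈ C := hA _ h
        rw [List.cons_append, val_old_cons h]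
        rw [colsAfter, Finset.insert_eq_of_mem hp] at hD
        rw [freshCount, Finset.insert_eq_of_mem hp, if_pos hp, zero_add] at hN
        refine (ih d C A _ z l hA hD (by rw [← hq]; simp [add_assoc]) hN).trans ?_
        have := tail_old (B := B) (d := d) (j := l.length) h (p + dvec a)
        simp only [List.length_cons]
        gcongr
      · rw [val_new h]
        have hA' : ∀ s ∈ insert (p, z) A, s.1 ∈ insert p C := by
          intro s hs
          rcases Finset.mem_insert.mp hs with rfl | hs
          · simp
          · exact Finset.mem_insert_of_mem (hA s hs)
        have hD' : colsAfter (insert p C) p (a :: l) = D := by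
          rw [← hD]; simp [colsAfter]
        have hN' : N ≤ d + 1 + freshCount (insert p C) p (a :: l) := by
          have := freshCount_cons_le C p a l
          omega
        have h1 := ih (d + 1) (insert p C) (insert (p, z) A) p (z + 1) (a :: l) hA' hD' hq hN'
        have h2 := ih (d + 1) (insert p C) (insert (p, z) A) p (z - 1) (a :: l) hA' hD' hq hN'
        have h3 := tail_new (B := B) (d := d) (j := (a :: l).length) h
        have h4 := hρ d (z - x.2)
        rw [show z + 1 - x.2 = z - x.2 + 1 by ring] at h1
        rw [show z - 1 - x.2 = z - x.2 - 1 by ring] at h2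
        have h5 := mul_le_mul_of_nonneg_left (add_le_add h4 h3) hc
        linarith

lemma val_append_le_of_forall {D : Finset (ℤ × ℤ)} {q : ℤ × ℤ} (hc : 0 ≤ c)
    (hnext : ∀ R (A : Finset ((ℤ × ℤ) × ℤ)) z, (∀ s ∈ A, s.1 ∈ D) → val x R A q z l₂ ≤ c)
    (R : ℕ) (C : Finset (ℤ × ℤ)) (A : Finset ((ℤ × ℤ) × ℤ)) (p : ℤ × ℤ) (z : ℤ)
    (l₁ : List (Bool × Bool)) (hA : ∀ s ∈ A, s.1 ∈ C) (hD : colsAfter C p l₁ = D)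
    (hq : p + pos l₁ = q) :
    val x R A p z (l₁ ++ l₂) ≤ c := by
  have h := val_append_le_supersolution (B := 0) (N := 0) (L := 0) (ρ := fun _ _ => 0) le_rfl hc
    (fun R A z hA => by simpa using hnext R A z hA) (fun _ _ => le_rfl) (by simp)
    (by simp) R 0 C A p z l₁ hA hD hq (Nat.zero_le _)
  simpa using h

end window

/-- The sine of `t` truncated at `π / 2`. -/
noncomputable def sinCut (t : ℝ) : ℝ := Real.sin (min t (Real.pi / 2))

lemma sinCut_le_one (t : ℝ) : sinCut t ≤ 1 := Real.sin_le_one _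

lemma sinCut_nonneg {t : ℝ} (ht : 0 ≤ t) : 0 ≤ sinCut t :=
  Real.sin_nonneg_of_nonneg_of_le_pi (le_min ht (by positivity))
    ((min_le_right _ _).trans (by linarith [Real.pi_pos]))

lemma sinCut_le_self {t : ℝ} (ht : 0 ≤ t) : sinCut t ≤ t :=
  (Real.sin_le (le_min ht (by positivity))).trans (min_le_left _ _)

lemma sin_le_sinCut (t : ℝ) : Real.sin t ≤ sinCut t := by
  unfold sinCut
  rcases le_total t (Real.pi / 2) with h | h
  · rw [min_eq_left h]
  · rw [min_eq_right h, Real.sin_pi_div_two]; exact Real.sin_le_one t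

lemma two_div_pi_mul_le_sinCut {t u : ℝ} (ht : 0 ≤ t) (htu : t ≤ u) (ht1 : t ≤ 1) :
    2 / Real.pi * t ≤ sinCut u := by
  have h1 : t ≤ Real.pi / 2 := by linarith [Real.pi_gt_three]
  refine (Real.mul_le_sin ht h1).trans ?_
  exact Real.sin_le_sin_of_le_of_le_pi_div_two (by linarith [Real.pi_pos]) (min_le_right _ _)
    (le_min htu h1)

lemma cos_mul_sinCut_le {θ t : ℝ} (hθ : 0 ≤ θ) (hθ1 : θ ≤ 1) :
    Real.cos θ * sinCut t ≤ (sinCut (t + θ) + sinCut (t - θ)) / 2 := by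
  have hpi := Real.pi_pos
  rcases le_or_gt t (Real.pi / 2) with h | h
  · have h1 := sin_le_sinCut (t + θ)
    have h2 := sin_le_sinCut (t - θ)
    rw [Real.sin_add] at h1
    rw [Real.sin_sub] at h2
    have h3 : sinCut t = Real.sin t := by rw [sinCut, min_eq_left h]
    rw [h3]
    linarith
  · have h1 : sinCut t = 1 := by rw [sinCut, min_eq_right h.le, Real.sin_pi_div_two]
    have h2 : sinCut (t + θ) = 1 := by
      rw [sinCut, min_eq_right (by linarith), Real.sin_pi_div_two]
    rw [h1, h2]
    have h3 := Real.cos_le_one θ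
    have h4 : Real.cos θ ≤ sinCut (t - θ) := by
      rw [← Real.sin_pi_div_two_sub]
      exact Real.sin_le_sin_of_le_of_le_pi_div_two (by linarith [Real.pi_gt_three])
        (min_le_right _ _) (le_min (by linarith) (by linarith))
    linarith

lemma cos_mul_sinCut_abs_le {θ : ℝ} (hθ : 0 ≤ θ) (hθ1 : θ ≤ 1) (y : ℤ) :
    Real.cos θ * sinCut (θ * |y|) ≤
      (sinCut (θ * |(y + 1 : ℤ)|) + sinCut (θ * |(y - 1 : ℤ)|)) / 2 := by
  rcases lt_trichotomy y 0 with h | rfl | h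
  · rw [abs_of_nonpos (by omega : y + 1 ≤ 0), abs_of_neg (by omega : y - 1 < 0), abs_of_neg h]
    have := cos_mul_sinCut_le (t := θ * (-y : ℤ)) hθ hθ1
    push_cast at *
    rw [show θ * (-((y : ℝ) + 1)) = θ * -y - θ by ring,
      show θ * (-((y : ℝ) - 1)) = θ * -y + θ by ring]
    linarith
  · simp only [abs_zero, Int.cast_zero, mul_zero, sinCut]
    rw [min_eq_left (by positivity), Real.sin_zero, mul_zero]
    have := sinCut_nonneg (t := θ * |((0 + 1 : ℤ))|) (by positivity)
    have := sinCut_nonneg (t := θ * |((0 - 1 : ℤ))|) (by positivity)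
    unfold sinCut at *
    linarith
  · rw [abs_of_pos (by omega : 0 < y + 1), abs_of_nonneg (by omega : 0 ≤ y - 1), abs_of_pos h]
    have := cos_mul_sinCut_le (t := θ * y) hθ hθ1
    push_cast at *
    rw [show θ * ((y : ℝ) + 1) = θ * y + θ by ring,
      show θ * ((y : ℝ) - 1) = θ * y - θ by ring]
    linarith

/-- A lower bound for the probability that the vertical walk is away from the origin. -/
noncomputable def awayOne (θ : ℝ) (B L d : ℕ) (y : ℤ) : ℝ :=
  Real.cos θ ^ (B - d) * sinCut (θ * |y|) - θ * L

/-- A lower bound for the probability that the vertical walk is away from the origin, which is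
useful before time `h ^ 2` and at distance at most `h`. -/
noncomputable def awayTwo (θ : ℝ) (h L d : ℕ) (y : ℤ) : ℝ :=
  1 / 8 * θ * ((y : ℝ) ^ 2 + h ^ 2 - d) / h - θ * L

/-- An upper bound for the probability that the vertical walk is near the origin. -/
noncomputable def near (θ : ℝ) (B h L d : ℕ) (y : ℤ) : ℝ :=
  if B ≤ d then 0 else 1 - if d < h ^ 2 ∧ |y| < (h : ℤ) then
    max (awayOne θ B L d y) (awayTwo θ h L d y) else awayOne θ B L d y

section near
variable {θ : ℝ} {B h L : ℕ}

lemma half_le_cos_pow (hθB : θ ^ 2 * B ≤ 1) (hθ1 : θ ≤ 1) (hθ : 0 < θ) {k : ℕ} (hk : k ≤ B) :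
    1 / 2 ≤ Real.cos θ ^ k := by
  have h1 := Real.one_sub_sq_div_two_le_cos (x := θ)
  have h2 : 1 + (k : ℝ) * (-(θ ^ 2 / 2)) ≤ (1 + -(θ ^ 2 / 2)) ^ k :=
    one_add_mul_le_pow (by nlinarith) k
  have h3 : (1 + -(θ ^ 2 / 2)) ^ k ≤ Real.cos θ ^ k :=
    pow_le_pow_left₀ (by nlinarith) (by linarith) k
  have h4 : θ ^ 2 * k ≤ θ ^ 2 * B := by gcongr
  linarith

lemma awayOne_ge (hθB : θ ^ 2 * B ≤ 1) (hθ1 : θ ≤ 1) (hθ : 0 < θ) {t : ℝ} (ht : 0 ≤ t)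
    (ht1 : t ≤ 1) {y : ℤ} (hty : t ≤ θ * |y|) (d : ℕ) : t / 4 - θ * L ≤ awayOne θ B L d y := by
  have h1 := half_le_cos_pow hθB hθ1 hθ (Nat.sub_le B d)
  have h2 := two_div_pi_mul_le_sinCut ht hty ht1
  have h3 : 1 / 2 * t ≤ 2 / Real.pi * t := by
    refine mul_le_mul_of_nonneg_right ?_ ht
    rw [div_le_div_iff₀ (by norm_num) Real.pi_pos]
    linarith [Real.pi_le_four]
  have h4 : 1 / 2 * (1 / 2 * t) ≤ Real.cos θ ^ (B - d) * sinCut (θ * |y|) := by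
    apply mul_le_mul h1 (h3.trans h2) (by positivity) (by linarith)
  unfold awayOne
  linarith

lemma awayOne_le (hθ1 : θ ≤ 1) (hθ : 0 < θ) (d : ℕ) (y : ℤ) :
    awayOne θ B L d y ≤ sinCut (θ * |y|) - θ * L := by
  have h0 : 0 ≤ Real.cos θ :=
    Real.cos_nonneg_of_neg_pi_div_two_le_of_le (by linarith [Real.pi_pos])
      (by linarith [Real.pi_gt_three])
  have h1 : Real.cos θ ^ (B - d) ≤ 1 := pow_le_one₀ h0 (Real.cos_le_one θ)
  have h2 := sinCut_nonneg (t := θ * |y|) (by positivity)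
  unfold awayOne
  nlinarith

lemma near_nonneg (hθ1 : θ ≤ 1) (hθ : 0 < θ) (hθh : θ * h ≤ 1) (d : ℕ) (y : ℤ) :
    0 ≤ near θ B h L d y := by
  have hL : 0 ≤ θ * L := by positivity
  have h1 := awayOne_le (B := B) (L := L) hθ1 hθ d y
  have h2 := sinCut_le_one (θ * |y|)
  have h4 : |y| < (h : ℤ) → awayTwo θ h L d y ≤ 1 := by
    intro hy
    have h5 : ((y : ℝ)) ^ 2 ≤ h ^ 2 := by
      rw [sq_le_sq, Nat.abs_cast]
      exact_mod_cast hy.le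
    have hh : (0 : ℝ) < h := by
      have := abs_nonneg y
      exact_mod_cast (by omega : 0 < h)
    have h6 : 1 / 8 * θ * ((y : ℝ) ^ 2 + h ^ 2 - d) / h ≤ 1 / 8 * θ * (2 * h ^ 2) / h := by
      have : (0 : ℝ) ≤ d := Nat.cast_nonneg d
      gcongr
      linarith
    have h7 : 1 / 8 * θ * (2 * (h : ℝ) ^ 2) / h = 1 / 4 * (θ * h) := by field_simp; ring
    unfold awayTwo
    linarith
  unfold near
  split_ifs with ha hb
  · exact le_rfl
  · have := max_le (a := awayOne θ B L d y) (by linarith) (h4 hb.2)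
    linarith
  · linarith

lemma awayOne_step (hθ1 : θ ≤ 1) (hθ : 0 < θ) {d : ℕ} (hd : d < B) (y : ℤ) :
    awayOne θ B L d y ≤ (awayOne θ B L (d + 1) (y + 1) + awayOne θ B L (d + 1) (y - 1)) / 2 := by
  have h0 : 0 ≤ Real.cos θ :=
    Real.cos_nonneg_of_neg_pi_div_two_le_of_le (by linarith [Real.pi_pos])
      (by linarith [Real.pi_gt_three])
  have h1 := cos_mul_sinCut_abs_le hθ.le hθ1 y
  unfold awayOne
  rw [show B - d = B - (d + 1) + 1 by omega, pow_succ, mul_assoc]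
  have := mul_le_mul_of_nonneg_left h1 (pow_nonneg h0 (B - (d + 1)))
  linarith

lemma awayTwo_step (d : ℕ) (y : ℤ) :
    awayTwo θ h L d y = (awayTwo θ h L (d + 1) (y + 1) + awayTwo θ h L (d + 1) (y - 1)) / 2 := by
  unfold awayTwo
  push_cast
  ring

lemma near_le_of_awayOne {d : ℕ} (hd : d < B) (y : ℤ) :
    near θ B h L d y ≤ 1 - awayOne θ B L d y := by
  unfold near
  rw [if_neg (by omega)]
  gcongr
  split_ifs
  · exact le_max_left _ _
  · exact le_rfl

lemma near_le_of_awayTwo (hθB : θ ^ 2 * B ≤ 1) (hθ1 : θ ≤ 1) (hθ : 0 < θ) (hθh : θ * h ≤ 1)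
    (hh : 1 ≤ h) {d : ℕ} (hd : d < B) {y : ℤ} (hdh : d ≤ h ^ 2) (hy : |y| ≤ (h : ℤ)) :
    near θ B h L d y ≤ 1 - awayTwo θ h L d y := by
  have hh' : (0 : ℝ) < h := by exact_mod_cast hh
  have hyh : |(y : ℝ)| ≤ h := by exact_mod_cast hy
  by_cases hc : d < h ^ 2 ∧ |y| < (h : ℤ)
  · unfold near
    rw [if_neg (by omega), if_pos hc]
    gcongr
    exact le_max_right _ _
  · refine (near_le_of_awayOne hd y).trans ?_
    have h1 : awayTwo θ h L d y ≤ θ * |(y : ℝ)| / 4 - θ * L := by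
      have h2 : (y : ℝ) ^ 2 + h ^ 2 - d ≤ 2 * |(y : ℝ)| * h := by
        rcases eq_or_lt_of_le hy with h3 | h3
        · have h3' : |(y : ℝ)| = h := by exact_mod_cast h3
          have : (0 : ℝ) ≤ d := Nat.cast_nonneg d
          rw [← sq_abs, h3']
          nlinarith
        · have h4 : (d : ℝ) = h ^ 2 := by
            exact_mod_cast (by omega : d = h ^ 2)
          rw [h4, ← sq_abs]
          nlinarith [abs_nonneg (y : ℝ)]
      have h5 : 1 / 8 * θ * ((y : ℝ) ^ 2 + h ^ 2 - d) / h ≤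
          1 / 8 * θ * (2 * |(y : ℝ)| * h) / h := by gcongr
      have h6 : 1 / 8 * θ * (2 * |(y : ℝ)| * h) / h = θ * |(y : ℝ)| / 4 := by
        field_simp; ring
      unfold awayTwo
      linarith
    have h7 := awayOne_ge (L := L) hθB hθ1 hθ (t := θ * |(y : ℝ)|) (by positivity)
      ((mul_le_mul_of_nonneg_left hyh hθ.le).trans hθh) (y := y) (by push_cast; exact le_rfl) d
    linarith

lemma near_step (hθB : θ ^ 2 * B ≤ 1) (hθ1 : θ ≤ 1) (hθ : 0 < θ) (hθh : θ * h ≤ 1) (hh : 1 ≤ h)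
    (d : ℕ) (y : ℤ) :
    (near θ B h L (d + 1) (y + 1) + near θ B h L (d + 1) (y - 1)) / 2 ≤ near θ B h L d y := by
  rcases Nat.lt_or_ge (d + 1) B with hd | hd
  · have h1 : (near θ B h L (d + 1) (y + 1) + near θ B h L (d + 1) (y - 1)) / 2 ≤
        1 - awayOne θ B L d y := by
      have := awayOne_step (L := L) hθ1 hθ (by omega : d < B) y
      have := near_le_of_awayOne (θ := θ) (h := h) (L := L) hd (y + 1)
      have := near_le_of_awayOne (θ := θ) (h := h) (L := L) hd (y - 1)
      linarith
    conv_rhs => rw [near, if_neg (by omega)]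
    split_ifs with hc
    · have hy := abs_lt.mp hc.2
      have := awayTwo_step (θ := θ) (h := h) (L := L) d y
      have := near_le_of_awayTwo (L := L) hθB hθ1 hθ hθh hh hd (y := y + 1) (by omega)
        (abs_le.mpr ⟨by omega, by omega⟩)
      have := near_le_of_awayTwo (L := L) hθB hθ1 hθ hθh hh hd (y := y - 1) (by omega)
        (abs_le.mpr ⟨by omega, by omega⟩)
      rcases max_cases (awayOne θ B L d y) (awayTwo θ h L d y) with ⟨h5, _⟩ | ⟨h5, _⟩ <;>
        rw [h5] <;> linarith
    · exact h1
  · have h1 : ∀ y, near θ B h L (d + 1) y = 0 := fun y => by rw [near, if_pos hd]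
    rw [h1, h1]
    simpa using near_nonneg hθ1 hθ hθh d y

lemma one_le_near (hθ1 : θ ≤ 1) (hθ : 0 < θ) {d : ℕ} (hdh : h ^ 2 ≤ d) (hd : d < B) {y : ℤ}
    (hy : |y| ≤ (L : ℤ)) : 1 ≤ near θ B h L d y := by
  unfold near
  rw [if_neg (by omega), if_neg (by omega)]
  have h1 := awayOne_le (B := B) (L := L) hθ1 hθ d y
  have h2 := sinCut_le_self (t := θ * |y|) (by positivity)
  have h3 : θ * (|y| : ℤ) ≤ θ * L := by
    gcongr
    exact_mod_cast hy
  linarith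

lemma near_zero_le (hθB : θ ^ 2 * B ≤ 1) (hθ1 : θ ≤ 1) (hθ : 0 < θ) (hθh : θ * h ≤ 1)
    (hh : 1 ≤ h) (hL : 16 * L ≤ h) (hB : 0 < B) (y : ℤ) :
    near θ B h L 0 y ≤ 1 - θ * h / 16 := by
  have hh' : (0 : ℝ) < h := by exact_mod_cast hh
  have hL' : θ * (16 * L) ≤ θ * h := by gcongr; exact_mod_cast hL
  rcases lt_or_ge |y| (h : ℤ) with hy | hy
  · refine (near_le_of_awayTwo hθB hθ1 hθ hθh hh hB (Nat.zero_le _) hy.le).trans ?_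
    have h1 : θ * h / 8 - θ * L ≤ awayTwo θ h L 0 y := by
      have h2 : 1 / 8 * θ * ((h : ℝ) ^ 2) / h ≤
          1 / 8 * θ * ((y : ℝ) ^ 2 + h ^ 2 - (0 : ℕ)) / h := by
        gcongr
        have := sq_nonneg (y : ℝ)
        push_cast
        linarith
      have h3 : 1 / 8 * θ * ((h : ℝ) ^ 2) / h = θ * h / 8 := by field_simp
      unfold awayTwo
      linarith
    linarith
  · refine (near_le_of_awayOne hB y).trans ?_
    have h1 := awayOne_ge (L := L) hθB hθ1 hθ (t := θ * h) (by positivity) hθh (y := y)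
      (by gcongr; exact_mod_cast hy) 0
    have : 0 ≤ θ * h := by positivity
    linarith

end near

lemma val_append_le_window {x : (ℤ × ℤ) × ℤ} {c e : ℝ} (hc : 0 ≤ c) (he : 0 ≤ e)
    {θ : ℝ} {B h L : ℕ} (hθB : θ ^ 2 * B ≤ 1) (hθ1 : θ ≤ 1) (hθ : 0 < θ) (hθh : θ * h ≤ 1)
    (hh : 1 ≤ h) (hL : 16 * L ≤ h) (hB : 0 < B)
    {C : Finset (ℤ × ℤ)} {p : ℤ × ℤ} {l₁ l₂ : List (Bool × Bool)}
    (hnext : ∀ R (A : Finset ((ℤ × ℤ) × ℤ)) z, (∀ s ∈ A, s.1 ∈ colsAfter C p l₁) →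
      val x R A (p + pos l₁) z l₂ ≤ (if |z - x.2| ≤ L then c else 0) + e)
    (hfresh : h ^ 2 ≤ freshCount C p l₁)
    (R : ℕ) (A : Finset ((ℤ × ℤ) × ℤ)) (z : ℤ) (hA : ∀ s ∈ A, s.1 ∈ C) :
    val x R A p z (l₁ ++ l₂) ≤
      c * (1 - θ * h / 16 + (8 / 3) ^ (l₁.length + 1) * (3 / 4) ^ B) + e := by
  refine (val_append_le_supersolution (ρ := near θ B h L) (N := h ^ 2) hc he hnext
    (near_nonneg hθ1 hθ hθh) (near_step hθB hθ1 hθ hθh hh)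
    (fun d y hN hd hy => one_le_near hθ1 hθ hN hd hy) R 0 C A p z l₁ hA rfl rfl
    (by omega)).trans ?_
  have h1 := near_zero_le hθB hθ1 hθ hθh hh hL hB (z - x.2)
  have h2 := tail_zero_le (B := B) (A := A) (p := p) (z := z) (j := l₁.length)
  gcongr

lemma eight_thirds_pow_mul_le {k s m : ℕ} (hk : k ≤ s) (hs : m ≤ s) :
    (8 / 3 : ℝ) ^ (k + 1) * (3 / 4) ^ (8 * s) ≤ 3 * (1 / 2) ^ m := by
  calc (8 / 3 : ℝ) ^ (k + 1) * (3 / 4) ^ (8 * s)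
      ≤ (8 / 3 : ℝ) ^ (s + 1) * (3 / 4) ^ (8 * s) := by
        gcongr; norm_num
    _ = 8 / 3 * (8 / 3 * (3 / 4) ^ 8) ^ s := by rw [pow_succ, pow_mul, mul_pow]; ring
    _ ≤ 3 * (1 / 2) ^ s := by gcongr <;> norm_num
    _ ≤ 3 * (1 / 2) ^ m := by
        gcongr ?_ * ?_
        exact pow_le_pow_of_le_one (by norm_num) (by norm_num) hs

lemma val_le_of_far {x : (ℤ × ℤ) × ℤ} {f m : ℕ} (hf : m ≤ f) {l : List (Bool × Bool)}
    (hl : l.length = 4 ^ f) {z : ℤ} (hz : ((3 * m * 2 ^ f : ℕ) : ℤ) ≤ |z - x.2|)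
    (R : ℕ) (A : Finset ((ℤ × ℤ) × ℤ)) (p : ℤ × ℤ) :
    val x R A p z l ≤ 5 * (1 / 2) ^ m := by
  set c : ℝ := 1 / (3 * 2 ^ f) with hc
  have hc0 : 0 < c := by positivity
  have h1 := val_le_exp_add_tail c (8 * 4 ^ f) 0 x R A p z l
  have hm : m ≤ 4 ^ f := hf.trans (Nat.lt_pow_self (by norm_num)).le
  have h2 := tail_zero_le (B := 8 * 4 ^ f) (A := A) (p := p) (z := z) (j := l.length)
  have h3 := eight_thirds_pow_mul_le (le_of_eq hl) hm
  have h4 : Real.cosh c ^ (8 * 4 ^ f - 0) ≤ Real.exp (1 / 2) := by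
    calc Real.cosh c ^ (8 * 4 ^ f - 0) ≤ Real.exp (c ^ 2 / 2) ^ (8 * 4 ^ f) := by
          exact pow_le_pow_left₀ (Real.cosh_pos c).le (Real.cosh_le_exp_half_sq c) _
      _ = Real.exp ((8 * 4 ^ f : ℕ) * (c ^ 2 / 2)) := by rw [← Real.exp_nat_mul]
      _ ≤ Real.exp (1 / 2) := by
          apply Real.exp_le_exp.mpr
          rw [hc]
          push_cast
          rw [div_pow, mul_pow, ← pow_mul, mul_comm f 2, pow_mul]
          norm_num
          field_simp
          norm_num
  have h5 : Real.exp (-(c * |z - x.2|)) ≤ Real.exp (-m) := by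
    apply Real.exp_le_exp.mpr
    have h6 : ((3 * m * 2 ^ f : ℕ) : ℝ) ≤ (|z - x.2| : ℤ) := by exact_mod_cast hz
    have h7 : (m : ℝ) = c * ((3 * m * 2 ^ f : ℕ) : ℝ) := by
      rw [hc]; push_cast; field_simp
    rw [neg_le_neg_iff, h7]
    gcongr
  have h8 : Real.exp (1 / 2) ≤ 2 := by
    have h9 : Real.exp (1 / 2) ^ 2 = Real.exp 1 := by rw [← Real.exp_nat_mul]; norm_num
    have h10 := Real.exp_one_lt_d9
    nlinarith [Real.exp_pos (1 / 2)]
  have h11 : Real.exp (-m) ≤ (1 / 2) ^ m := by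
    have h12 : Real.exp (-1) ≤ 1 / 2 := by
      rw [Real.exp_neg, inv_le_comm₀ (Real.exp_pos 1) (by norm_num)]
      have := Real.add_one_le_exp 1
      norm_num at *
      linarith
    calc Real.exp (-m) = Real.exp (-1) ^ m := by rw [← Real.exp_nat_mul]; ring_nf
      _ ≤ _ := pow_le_pow_left₀ (Real.exp_pos _).le h12 m
  have h13 : Real.cosh c ^ (8 * 4 ^ f - 0) * Real.exp (-(c * |z - x.2|)) ≤ 2 * (1 / 2) ^ m :=
    mul_le_mul (h4.trans h8) (h5.trans h11) (Real.exp_pos _).le (by norm_num)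
  push_cast at *
  linarith

lemma val_append_le_geometric {x : (ℤ × ℤ) × ℤ} {c : ℝ} (hc : 0 ≤ c) (hc1 : c ≤ 1)
    {f m : ℕ} (hm : 1 ≤ m) (hm' : 96 * m ^ 7 ≤ 2 ^ m) (hf : m ≤ f)
    {C : Finset (ℤ × ℤ)} {p : ℤ × ℤ} {l₁ l₂ : List (Bool × Bool)}
    (hl₁ : l₁.length ≤ 4 ^ (f + m)) (hl₂ : l₂.length = 4 ^ f)
    (hnext : ∀ R (A : Finset ((ℤ × ℤ) × ℤ)) z, (∀ s ∈ A, s.1 ∈ colsAfter C p l₁) →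
      val x R A (p + pos l₁) z l₂ ≤ c)
    (hfresh : (2 ^ (f + m) / m ^ 6) ^ 2 ≤ freshCount C p l₁)
    (R : ℕ) (A : Finset ((ℤ × ℤ) × ℤ)) (z : ℤ) (hA : ∀ s ∈ A, s.1 ∈ C) :
    val x R A p z (l₁ ++ l₂) ≤ c * (1 - 1 / (96 * m ^ 6)) + 8 * (1 / 2) ^ m := by
  set h : ℕ := 2 ^ (f + m) / m ^ 6 with hh
  have hm6 : 0 < m ^ 6 := by positivity
  have hL : 16 * (3 * m * 2 ^ f) ≤ h := by
    rw [hh, Nat.le_div_iff_mul_le hm6, pow_add]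
    calc 16 * (3 * m * 2 ^ f) * m ^ 6 = 2 ^ f * (48 * m ^ 7) := by ring
      _ ≤ _ := by gcongr; omega
  have h1 : 1 ≤ h := by
    refine le_trans ?_ hL
    have : 0 < 16 * (3 * m * 2 ^ f) := by positivity
    omega
  have h2 : h ≤ 2 ^ (f + m) := Nat.div_le_self _ _
  have h2' : (h : ℝ) ≤ 2 ^ (f + m) := by exact_mod_cast h2
  have h3 : (2 : ℝ) ^ (f + m) ≤ 2 * m ^ 6 * h := by
    have h4 : 2 ^ (f + m) < (h + 1) * m ^ 6 := by
      exact (Nat.div_lt_iff_lt_mul hm6).mp (Nat.lt_succ_self _)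
    have h5 : 2 ^ (f + m) ≤ 2 * m ^ 6 * h := by nlinarith
    exact_mod_cast h5
  have key := val_append_le_window (x := x) (e := 5 * (1 / 2) ^ m) (θ := 1 / (3 * 2 ^ (f + m)))
    (B := 8 * 4 ^ (f + m)) (h := h) (L := 3 * m * 2 ^ f) hc (by positivity)
    (by
      push_cast
      rw [div_pow, mul_pow, ← pow_mul, mul_comm (f + m) 2, pow_mul]
      norm_num
      have : (0 : ℝ) < 4 ^ (f + m) := by positivity
      field_simp
      norm_num)
    (by
      rw [div_le_one (by positivity)]
      have : (1 : ℝ) ≤ 2 ^ (f + m) := one_le_pow₀ (by norm_num)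
      linarith)
    (by positivity)
    (by
      rw [div_mul_eq_mul_div, one_mul, div_le_one (by positivity)]
      have : (0 : ℝ) < 2 ^ (f + m) := by positivity
      linarith)
    h1 hL (by positivity) (C := C) (p := p) (l₁ := l₁) (l₂ := l₂)
    (by
      intro R A z hA
      split_ifs with hz
      · have := hnext R A z hA
        have : (0 : ℝ) ≤ 5 * (1 / 2) ^ m := by positivity
        linarith
      · rw [zero_add]
        exact val_le_of_far hf hl₂ (by omega) R A _)
    hfresh R A z hA
  refine key.trans ?_
  have hfm : m ≤ 4 ^ (f + m) :=
    (Nat.le_add_left m f).trans (Nat.lt_pow_self (by norm_num)).le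
  have h6 := eight_thirds_pow_mul_le hl₁ hfm
  have h7 : 1 / (96 * (m : ℝ) ^ 6) ≤ 1 / (3 * 2 ^ (f + m)) * h / 16 := by
    have hm0 : (0 : ℝ) < m := by exact_mod_cast hm
    rw [div_mul_eq_mul_div, div_div, div_le_div_iff₀ (by positivity) (by positivity)]
    linarith
  have h8 : c * (8 / 3 : ℝ) ^ (l₁.length + 1) * (3 / 4) ^ (8 * 4 ^ (f + m)) ≤
      3 * (1 / 2) ^ m := by
    rw [mul_assoc]
    refine le_trans ?_ h6
    exact mul_le_of_le_one_left (by positivity) hc1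
  have h9 := mul_le_mul_of_nonneg_left h7 hc
  nlinarith

/-- The increments of the path during the window between the times `n - 4 ^ (f + m)` and
`n - 4 ^ f` visit enough new points. -/
def IsGoodWindow (n m f : ℕ) (l : List (Bool × Bool)) : Prop :=
  (2 ^ (f + m) / m ^ 6) ^ 2 ≤ freshCount (colsAfter ∅ 0 (l.take (n - 4 ^ (f + m))))
    (pos (l.take (n - 4 ^ (f + m))))
    ((l.take (n - 4 ^ f)).drop (n - 4 ^ (f + m)))

lemma val_drop_le {x : (ℤ × ℤ) × ℤ} {m f₀ J n : ℕ} (hm : 1 ≤ m) (hm' : 96 * m ^ 7 ≤ 2 ^ m)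
    (hf₀ : m ≤ f₀) {l : List (Bool × Bool)} (hl : l.length = n)
    (hgood : ∀ j < J, IsGoodWindow n m (f₀ + j * m) l) (hJ : 4 ^ (f₀ + J * m) ≤ n)
    (R : ℕ) (A : Finset ((ℤ × ℤ) × ℤ)) (z : ℤ)
    (hA : ∀ s ∈ A, s.1 ∈ colsAfter ∅ 0 (l.take (n - 4 ^ (f₀ + J * m)))) :
    val x R A (pos (l.take (n - 4 ^ (f₀ + J * m)))) z (l.drop (n - 4 ^ (f₀ + J * m))) ≤
      (1 - 1 / (96 * m ^ 6)) ^ J + J * (8 * (1 / 2) ^ m) := by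
  induction J generalizing R A z with
  | zero => simpa using val_le_one
  | succ J ih =>
    set F := f₀ + J * m with hF
    have hF1 : f₀ + (J + 1) * m = F + m := by rw [hF]; ring
    rw [hF1] at hJ hA ⊢
    have hpow : 4 ^ F ≤ 4 ^ (F + m) := Nat.pow_le_pow_right (by norm_num) (by omega)
    have hle : n - 4 ^ (F + m) ≤ n - 4 ^ F := Nat.sub_le_sub_left hpow n
    have ih' := ih (fun j hj => hgood j (by omega)) (hpow.trans hJ)
    have hg : IsGoodWindow n m F l := hgood J (by omega)
    set C := colsAfter ∅ 0 (l.take (n - 4 ^ (F + m)))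
    set p := pos (l.take (n - 4 ^ (F + m)))
    set w := (l.take (n - 4 ^ F)).drop (n - 4 ^ (F + m)) with hw
    have htake : l.take (n - 4 ^ F) = l.take (n - 4 ^ (F + m)) ++ w := by
      rw [hw, List.drop_take, ← List.take_add, Nat.add_sub_cancel' hle]
    have hdrop : l.drop (n - 4 ^ (F + m)) = w ++ l.drop (n - 4 ^ F) := by
      apply List.append_cancel_left (as := l.take (n - 4 ^ (F + m)))
      rw [List.take_append_drop, ← List.append_assoc, ← htake, List.take_append_drop]
    have hwlen : w.length ≤ 4 ^ (F + m) := by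
      rw [hw, List.length_drop, List.length_take, hl]
      exact (Nat.sub_le_sub_right (min_le_right _ _) _).trans (Nat.sub_sub_self hJ).le
    have hη : 0 ≤ 1 - 1 / (96 * (m : ℝ) ^ 6) := by
      have h1 : (1 : ℝ) ≤ (m : ℝ) ^ 6 := one_le_pow₀ (by exact_mod_cast hm)
      rw [sub_nonneg, div_le_one (by positivity)]
      linarith
    set c : ℝ := min 1 ((1 - 1 / (96 * m ^ 6)) ^ J + J * (8 * (1 / 2) ^ m)) with hc
    have hc0 : 0 ≤ c := le_min zero_le_one (by positivity)
    have key := val_append_le_geometric (x := x) hc0 (min_le_left _ _) hm hm'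
      (f := F) (by omega) (C := C) (p := p) hwlen
      (l₂ := l.drop (n - 4 ^ F)) (by
        rw [List.length_drop, hl]
        exact Nat.sub_sub_self (hpow.trans hJ))
      (by
        intro R A z hA
        have hpos : p + pos w = pos (l.take (n - 4 ^ F)) := by rw [htake, pos_append]
        rw [hpos]
        refine le_min val_le_one (ih' R A z ?_)
        intro s hs
        rw [htake, colsAfter_append, zero_add]
        exact hA s hs) hg R A z hA
    rw [hdrop]
    refine key.trans ?_
    have h2 : c * (1 - 1 / (96 * (m : ℝ) ^ 6)) ≤
        ((1 - 1 / (96 * m ^ 6)) ^ J + J * (8 * (1 / 2) ^ m)) * (1 - 1 / (96 * (m : ℝ) ^ 6)) :=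
      mul_le_mul_of_nonneg_right (min_le_right _ _) hη
    have h3 : J * (8 * (1 / 2 : ℝ) ^ m) * (1 - 1 / (96 * (m : ℝ) ^ 6)) ≤
        J * (8 * (1 / 2) ^ m) := by
      apply mul_le_of_le_one_right (by positivity)
      rw [sub_le_self_iff]
      positivity
    rw [pow_succ (1 - 1 / (96 * (m : ℝ) ^ 6)) J, Nat.cast_succ]
    rw [add_mul] at h2
    linarith

lemma val_le_of_good {x : (ℤ × ℤ) × ℤ} {m f₀ J n : ℕ} (hm : 1 ≤ m) (hm' : 96 * m ^ 7 ≤ 2 ^ m)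
    (hf₀ : m ≤ f₀) {l : List (Bool × Bool)} (hl : l.length = n)
    (hgood : ∀ j < J, IsGoodWindow n m (f₀ + j * m) l) (hJ : 4 ^ (f₀ + J * m) ≤ n) (R : ℕ) :
    val x R ∅ 0 0 l ≤ (1 - 1 / (96 * m ^ 6)) ^ J + J * (8 * (1 / 2) ^ m) := by
  have hη : 0 ≤ 1 - 1 / (96 * (m : ℝ) ^ 6) := by
    have h1 : (1 : ℝ) ≤ (m : ℝ) ^ 6 := one_le_pow₀ (by exact_mod_cast hm)
    rw [sub_nonneg, div_le_one (by positivity)]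
    linarith
  have := val_append_le_of_forall (c := (1 - 1 / (96 * m ^ 6)) ^ J + J * (8 * (1 / 2 : ℝ) ^ m))
    (by positivity) (val_drop_le (x := x) hm hm' hf₀ hl hgood hJ) R ∅ ∅ 0 0
    (l.take (n - 4 ^ (f₀ + J * m))) (by simp) rfl (by simp)
  rwa [List.take_append_drop] at this

lemma card_vis_le (y : ℤ × ℤ) (l : List (Bool × Bool)) : (vis y l).card ≤ l.length + 1 := by
  induction l generalizing y with
  | nil => simp [vis]
  | cons a l ih => exact (Finset.card_insert_le _ _).trans (by simpa using ih _)

lemma freshCount_le_append (C : Finset (ℤ × ℤ)) (p : ℤ × ℤ) (l l' : List (Bool × Bool)) :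
    freshCount C p l ≤ freshCount C p (l ++ l') := by
  induction l generalizing C p with
  | nil => simp [freshCount]
  | cons a l ih => simpa [freshCount] using ih _ _

lemma card_inter_image_add (A B : Finset (ℤ × ℤ)) (c : ℤ × ℤ) :
    (A.image (· + c) ∩ B.image (· + c)).card = (A ∩ B).card := by
  rw [← Finset.image_inter _ _ (add_left_injective c),
    Finset.card_image_of_injective _ (add_left_injective c)]

/-- If the path visits few new points during a window then it visits few points, or many of the
points are visited before the window. -/
lemma card_vis_lt_or_of_freshCount_lt {l₁ l₂ l₃ l₄ : List (Bool × Bool)} {r H : ℕ}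
    (hH : 2 * H ≤ r)
    (h : freshCount (colsAfter ∅ 0 (l₁ ++ l₂)) (pos (l₁ ++ l₂)) (l₃ ++ l₄) < H) :
    (vis 0 l₃).card < r ∨
    (r ≤ (vis 0 l₃).card ∧ (vis 0 l₃).card ≤ 4 * (vis (pos l₁ + pos l₂) l₃ ∩ vis 0 l₁).card) ∨
    (r ≤ (vis 0 l₃).card ∧
      (vis 0 l₃).card ≤ 4 * ((vis 0 l₃).image (fun x => -x) ∩ vis 0 l₂.reverse).card) := by
  rcases Nat.lt_or_ge (vis 0 l₃).card r with hr | hr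
  · exact Or.inl hr
  right
  have h1 := (freshCount_le_append _ _ l₃ l₄).trans_lt h
  have h2 := card_vis_sdiff_le (colsAfter ∅ 0 (l₁ ++ l₂)) (pos (l₁ ++ l₂)) l₃
  have hsub : colsAfter ∅ 0 (l₁ ++ l₂) ⊆ vis 0 l₁ ∪ vis (pos l₁) l₂ := by
    refine (colsAfter_subset _ _ _).trans ?_
    rw [Finset.empty_union, vis_append, zero_add]
  rw [pos_append] at h1 h2
  generalize colsAfter ∅ 0 (l₁ ++ l₂) = C at h1 h2 hsub
  have h3 := Finset.card_sdiff_add_card_inter (vis (pos l₁ + pos l₂) l₃) C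
  rw [card_vis] at h3
  have h4 : (vis (pos l₁ + pos l₂) l₃ ∩ C).card ≤
      (vis (pos l₁ + pos l₂) l₃ ∩ vis 0 l₁).card +
        (vis (pos l₁ + pos l₂) l₃ ∩ vis (pos l₁) l₂).card := by
    refine (Finset.card_le_card (Finset.inter_subset_inter_left hsub)).trans ?_
    rw [Finset.inter_union_distrib_left]
    exact Finset.card_union_le _ _
  have h5 : (vis (pos l₁ + pos l₂) l₃ ∩ vis (pos l₁) l₂).card =
      ((vis 0 l₃).image (fun x => -x) ∩ vis 0 l₂.reverse).card := by
    have e1 : vis (pos l₁ + pos l₂) l₃ = (vis 0 l₃).image (· + (pos l₁ + pos l₂)) := by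
      rw [← vis_translate, zero_add]
    have e2 : vis (pos l₁) l₂ = (vis (-pos l₂) l₂).image (· + (pos l₁ + pos l₂)) := by
      rw [← vis_translate]
      congr 1
      abel
    rw [e1, e2, card_inter_image_add, vis_neg_pos]
    rw [← Finset.card_image_of_injective (vis 0 l₃ ∩ _) neg_injective,
      Finset.image_inter _ _ neg_injective, Finset.image_image]
    congr 2
    ext x
    simp
  by_cases h6 : (vis 0 l₃).card ≤ 4 * (vis (pos l₁ + pos l₂) l₃ ∩ vis 0 l₁).card
  · exact Or.inl ⟨hr, h6⟩
  · refine Or.inr ⟨hr, ?_⟩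
    omega

lemma pathMean_pos_add_mul_le {k : ℕ} (hk : 1 ≤ k) (v w : ℤ × ℤ) {c : ℝ} (hc : 0 ≤ c) :
    pathMean k (fun l => (if pos l + w = v then 1 else 0) * c) ≤ 1 / k * c := by
  rw [pathMean_mul_const]
  gcongr
  simp only [← eq_sub_iff_add_eq]
  rw [pathMean_pos_eq]
  exact planeProb_le hk _

open Classical in
lemma pathMean_bad_window_le {n m f a b u r : ℕ} {ε δ : ℝ} (v : ℤ × ℤ)
    (hn : n = a + b + 4 ^ (f + m)) (ha : n ≤ 4 * a) (hb : n ≤ 4 * b) (hn0 : 1 ≤ n)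
    (hu : u + 4 ^ f ≤ 4 ^ (f + m))
    (hr : 2 * (2 ^ (f + m) / m ^ 6) ^ 2 ≤ r)
    (hε : pathMean u (fun l => if (vis 0 l).card < r then 1 else 0) ≤ ε)
    (hδ : ∀ A : Finset (ℤ × ℤ), r ≤ A.card → A.card ≤ u + 1 → ∀ n' ≤ n,
      pathMean n' (fun l => if A.card ≤ 4 * (A ∩ vis 0 l).card then 1 else 0) ≤ δ)
    (hδ0 : 0 ≤ δ) :
    pathMean n (fun l => if ¬ IsGoodWindow n m f l ∧ pos l = v then 1 else 0) ≤
      4 / n * (ε + 2 * δ) := by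
  set s := 4 ^ (f + m) with hs
  have ha1 : 1 ≤ a := by omega
  have hb1 : 1 ≤ b := by omega
  have hn' : (0 : ℝ) < n := by exact_mod_cast hn0
  have hinv : ∀ k : ℕ, 1 ≤ k → n ≤ 4 * k → (1 / k : ℝ) ≤ 4 / n := fun k hk hnk => by
    have hk' : (0 : ℝ) < k := by exact_mod_cast hk
    rw [div_le_div_iff₀ hk' hn', one_mul]
    exact_mod_cast hnk
  have hε0 : 0 ≤ ε := (pathMean_nonneg fun l _ => by split_ifs <;> norm_num).trans hε
  have hus : u ≤ s := (Nat.le_add_right _ _).trans hu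
  let g3 : List (Bool × Bool) → ℝ := fun l => if (vis 0 (l.take u)).card < r then 1 else 0
  let g1 : List (Bool × Bool) → List (Bool × Bool) → ℝ := fun l₁ l =>
    if r ≤ (vis 0 (l.take u)).card ∧
      (vis 0 (l.take u)).card ≤ 4 * (vis (v - pos l) (l.take u) ∩ vis 0 l₁).card then 1 else 0
  let g2 : List (Bool × Bool) → List (Bool × Bool) → ℝ := fun l₂ l =>
    if r ≤ (vis 0 (l.take u)).card ∧ (vis 0 (l.take u)).card ≤
      4 * ((vis 0 (l.take u)).image (fun x => -x) ∩ vis 0 l₂.reverse).card then 1 else 0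
  have hg3 : ∀ l, 0 ≤ g3 l := fun l => by simp only [g3]; split_ifs <;> norm_num
  have hg1 : ∀ l l', 0 ≤ g1 l l' := fun l l' => by simp only [g1]; split_ifs <;> norm_num
  have hg2 : ∀ l l', 0 ≤ g2 l l' := fun l l' => by simp only [g2]; split_ifs <;> norm_num
  have hpt : ∀ l₁ l₂ l : List (Bool × Bool), l₁.length = a → l₂.length = b → l.length = s →
      (if ¬ IsGoodWindow n m f (l₁ ++ (l₂ ++ l)) ∧ pos (l₁ ++ (l₂ ++ l)) = v then (1 : ℝ) else 0) ≤
        (if pos l₁ + (pos l₂ + pos l) = v then 1 else 0) * g3 l +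
        (if pos l₂ + (pos l₁ + pos l) = v then 1 else 0) * g1 l₁ l +
        (if pos l₁ + (pos l₂ + pos l) = v then 1 else 0) * g2 l₂ l := by
    intro l₁ l₂ l h₁ h₂ h₃
    have hnn : 0 ≤ (if pos l₁ + (pos l₂ + pos l) = v then 1 else 0) * g3 l +
        (if pos l₂ + (pos l₁ + pos l) = v then 1 else 0) * g1 l₁ l +
        (if pos l₁ + (pos l₂ + pos l) = v then 1 else 0) * g2 l₂ l := by
      have := hg3 l; have := hg1 l₁ l; have := hg2 l₂ l
      split_ifs <;> positivity
    by_cases hbad : ¬ IsGoodWindow n m f (l₁ ++ (l₂ ++ l)) ∧ pos (l₁ ++ (l₂ ++ l)) = v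
    · rw [if_pos hbad]
      obtain ⟨hbad, hv⟩ := hbad
      rw [pos_append, pos_append] at hv
      have hv' : pos l₂ + (pos l₁ + pos l) = v := by rw [← hv]; abel
      rw [if_pos hv, if_pos hv', one_mul, one_mul, one_mul]
      rw [IsGoodWindow, not_le, ← List.append_assoc, ← hs] at hbad
      have e0 : n - s = (l₁ ++ l₂).length := by rw [List.length_append]; omega
      have e1 : (l₁ ++ l₂ ++ l).take (n - s) = l₁ ++ l₂ := by
        rw [e0, List.take_left]
      have e2 : ((l₁ ++ l₂ ++ l).take (n - 4 ^ f)).drop (n - s) =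
          l.take u ++ (l.take (s - 4 ^ f)).drop u := by
        have e3 : n - 4 ^ f = (l₁ ++ l₂).length + (s - 4 ^ f) := by
          rw [← e0]; omega
        have e5 : l.take u = (l.take (s - 4 ^ f)).take u := by
          rw [List.take_take, min_eq_left (by omega)]
        rw [e3, List.take_length_add_append, e0, List.drop_left, e5, List.take_append_drop]
      rw [e1, e2] at hbad
      have e4 : pos l₁ + pos l₂ = v - pos l := by rw [← hv]; abel
      have := card_vis_lt_or_of_freshCount_lt hr hbad
      rw [e4] at this
      have t3 := hg3 l; have t1 := hg1 l₁ l; have t2 := hg2 l₂ l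
      rcases this with h | h | h
      · have : g3 l = 1 := if_pos h
        linarith
      · have : g1 l₁ l = 1 := if_pos h
        linarith
      · have : g2 l₂ l = 1 := if_pos h
        linarith
    · rw [if_neg hbad]
      exact hnn
  have hcard : ∀ y (l : List (Bool × Bool)), l.length = s → (vis y (l.take u)).card ≤ u + 1 := by
    intro y l hl
    refine (card_vis_le _ _).trans ?_
    rw [List.length_take]
    omega
  have T3 : pathMean a (fun l₁ => pathMean b fun l₂ => pathMean s fun l =>
      (if pos l₁ + (pos l₂ + pos l) = v then 1 else 0) * g3 l) ≤ 4 / n * ε := by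
    rw [pathMean_comm]
    refine pathMean_le_const fun l₂ _ => ?_
    rw [pathMean_comm]
    calc _ ≤ pathMean s (fun l => 1 / a * g3 l) :=
          pathMean_mono fun l _ => pathMean_pos_add_mul_le ha1 _ _ (hg3 l)
      _ = 1 / a * pathMean s g3 := pathMean_const_mul _ _ _
      _ ≤ 4 / n * ε := by
          refine mul_le_mul (hinv a ha1 ha) ?_ (pathMean_nonneg fun l _ => hg3 l) (by positivity)
          rw [show s = u + (s - u) by omega, pathMean_append]
          refine le_trans (pathMean_mono fun l hl => ?_) hε
          refine pathMean_le_const fun l' _ => ?_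
          simp only [g3]
          rw [List.take_left' hl]
  have T1 : pathMean a (fun l₁ => pathMean b fun l₂ => pathMean s fun l =>
      (if pos l₂ + (pos l₁ + pos l) = v then 1 else 0) * g1 l₁ l) ≤ 4 / n * δ := by
    calc _ ≤ pathMean a (fun l₁ => pathMean s fun l => 1 / b * g1 l₁ l) := by
          refine pathMean_mono fun l₁ _ => ?_
          rw [pathMean_comm]
          exact pathMean_mono fun l _ => pathMean_pos_add_mul_le hb1 _ _ (hg1 _ _)
      _ ≤ 4 / n * δ := by
          rw [pathMean_comm]
          refine pathMean_le_const fun l hl => ?_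
          rw [pathMean_const_mul]
          refine mul_le_mul (hinv b hb1 hb) ?_ (pathMean_nonneg fun l _ => hg1 _ _)
            (by positivity)
          by_cases hrl : r ≤ (vis 0 (l.take u)).card
          · have := hδ (vis (v - pos l) (l.take u)) (by rwa [card_vis]) (hcard _ l hl) a (by omega)
            simpa only [g1, hrl, true_and, card_vis] using this
          · simp only [g1, hrl, false_and, if_false, pathMean_const]
            exact hδ0
  have T2 : pathMean a (fun l₁ => pathMean b fun l₂ => pathMean s fun l =>
      (if pos l₁ + (pos l₂ + pos l) = v then 1 else 0) * g2 l₂ l) ≤ 4 / n * δ := by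
    rw [pathMean_comm]
    calc _ ≤ pathMean b (fun l₂ => pathMean s fun l => 1 / a * g2 l₂ l) := by
          refine pathMean_mono fun l₂ _ => ?_
          rw [pathMean_comm]
          exact pathMean_mono fun l _ => pathMean_pos_add_mul_le ha1 _ _ (hg2 _ _)
      _ ≤ 4 / n * δ := by
          rw [pathMean_comm]
          refine pathMean_le_const fun l hl => ?_
          rw [pathMean_const_mul]
          refine mul_le_mul (hinv a ha1 ha) ?_ (pathMean_nonneg fun l _ => hg2 _ _)
            (by positivity)
          by_cases hrl : r ≤ (vis 0 (l.take u)).card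
          · have hc := Finset.card_image_of_injective (vis 0 (l.take u)) neg_injective
            have := hδ ((vis 0 (l.take u)).image (fun x => -x)) (by rwa [hc])
              (by rw [hc]; exact hcard _ l hl) b (by omega)
            rw [← pathMean_reverse] at this
            simpa only [g2, hrl, true_and, hc] using this
          · simp only [g2, hrl, false_and, if_false, pathMean_const]
            exact hδ0
  have hmain : pathMean n (fun l => if ¬ IsGoodWindow n m f l ∧ pos l = v then 1 else 0) ≤
      pathMean a (fun l₁ => pathMean b fun l₂ => pathMean s fun l =>
        (if pos l₁ + (pos l₂ + pos l) = v then 1 else 0) * g3 l +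
        (if pos l₂ + (pos l₁ + pos l) = v then 1 else 0) * g1 l₁ l +
        (if pos l₁ + (pos l₂ + pos l) = v then 1 else 0) * g2 l₂ l) := by
    have hsplit : ∀ φ : List (Bool × Bool) → ℝ, pathMean n φ =
        pathMean a (fun l₁ => pathMean b fun l₂ => pathMean s fun l =>
          φ (l₁ ++ (l₂ ++ l))) := fun φ => by
      rw [hn, add_assoc, pathMean_append]
      simp only [pathMean_append b s]
    rw [hsplit]
    exact pathMean_mono fun l₁ h₁ => pathMean_mono fun l₂ h₂ => pathMean_mono fun l h₃ =>
      hpt l₁ l₂ l h₁ h₂ h₃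
  simp only [pathMean_add] at hmain
  linarith

lemma log_window_le {m : ℕ} (hm : 1 ≤ m) :
    Real.log (64 * m ^ 11 * 4 ^ (m ^ 9)) ≤ 77 * (m : ℝ) ^ 9 := by
  have hm1 : (1 : ℝ) ≤ m := by exact_mod_cast hm
  have hm0 : (0 : ℝ) < m := by linarith
  rw [Real.log_mul (by positivity) (by positivity), Real.log_mul (by positivity) (by positivity),
    Real.log_pow, Real.log_pow]
  have h1 := Real.log_le_sub_one_of_pos (show (0 : ℝ) < 64 by norm_num)
  have h2 := Real.log_le_sub_one_of_pos hm0
  have h3 := Real.log_le_sub_one_of_pos (show (0 : ℝ) < 4 by norm_num)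
  have h4 : (1 : ℝ) ≤ (m : ℝ) ^ 9 := one_le_pow₀ hm1
  have h5 : (m : ℝ) ≤ (m : ℝ) ^ 9 := by
    simpa using pow_le_pow_right₀ hm1 (show 1 ≤ 9 by norm_num)
  have h6 : (m : ℝ) ^ 9 * Real.log 4 ≤ (m : ℝ) ^ 9 * 3 := by
    gcongr
    linarith
  push_cast
  linarith

lemma pathMean_dense_le {n m : ℕ} (hm : 1 ≤ m) (hn : 4 ≤ n) {A : Finset (ℤ × ℤ)}
    (hA : 128 ≤ A.card) (hAn : A.card ≤ 2 * n)
    (hq : 2 * (n : ℝ) / A.card ≤ 64 * m ^ 11 * 4 ^ (m ^ 9))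
    (hlog : (m : ℝ) ^ 10 / 2 ≤ Real.log n) {n' : ℕ} (hn' : n' ≤ n) :
    pathMean n' (fun l => if A.card ≤ 4 * (A ∩ vis 0 l).card then 1 else 0) ≤
      (323584 / m : ℝ) ^ 32 := by
  have hm1 : (1 : ℝ) ≤ m := by exact_mod_cast hm
  have hm0 : (0 : ℝ) < m := by linarith
  have hlog0 : 0 < Real.log n := lt_of_lt_of_le (by positivity) hlog
  have hA' : (128 : ℝ) ≤ A.card := by exact_mod_cast hA
  have hn0 : (4 : ℝ) ≤ n := by exact_mod_cast hn
  have hL : Real.log ((2 * n : ℕ) / A.card) ≤ 77 * (m : ℝ) ^ 9 := by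
    refine le_trans ?_ (log_window_le hm)
    apply Real.log_le_log
    · push_cast
      have : (0 : ℝ) < A.card := by linarith
      positivity
    · push_cast
      exact hq
  have hμ : ∀ k ≤ n', ∀ y, pathMean k (fun l => ((A ∩ vis y l).card : ℝ)) ≤
      A.card * (1264 / m) := by
    intro k hk y
    have h1 := pathMean_hits_mul_green_le k (n + 1) A y (by omega) (M := 2 * n) hAn (by omega)
    have h2 := green_ge n hn
    have h0 : 0 ≤ pathMean k (fun l => ((A ∩ vis y l).card : ℝ)) :=
      pathMean_nonneg fun l _ => Nat.cast_nonneg _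
    have h3 : (A.card : ℝ) * Real.log ((2 * n : ℕ) / A.card) ≤ A.card * (77 * (m : ℝ) ^ 9) := by
      gcongr
    have h4 : pathMean k (fun l => ((A ∩ vis y l).card : ℝ)) * ((m : ℝ) ^ 10 / 16) ≤
        A.card * (79 * (m : ℝ) ^ 9) := by
      have h5 : (m : ℝ) ^ 10 / 16 ≤ green (n + 1) := by linarith
      have h6 : (1 : ℝ) ≤ (m : ℝ) ^ 9 := one_le_pow₀ hm1
      have h7 := mul_le_mul_of_nonneg_left h5 h0
      nlinarith
    have h8 : pathMean k (fun l => ((A ∩ vis y l).card : ℝ)) * m ≤ A.card * 1264 := by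
      have h9 : (0 : ℝ) < (m : ℝ) ^ 9 / 16 := by positivity
      refine le_of_mul_le_mul_right ?_ h9
      calc _ = pathMean k (fun l => ((A ∩ vis y l).card : ℝ)) * ((m : ℝ) ^ 10 / 16) := by ring
        _ ≤ _ := h4
        _ = _ := by ring
    rw [← mul_div_assoc, le_div_iff₀ hm0]
    exact h8
  have hk : 1 ≤ A.card / 128 := by omega
  have hk' : (A.card : ℝ) ≤ 256 * (A.card / 128 : ℕ) := by
    exact_mod_cast (by omega : A.card ≤ 256 * (A.card / 128))
  have hk0 : (0 : ℝ) < (A.card / 128 : ℕ) := by exact_mod_cast hk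
  calc _ ≤ pathMean n' (fun l => if 32 * (A.card / 128) ≤ (A ∩ vis 0 l).card then 1 else 0) := by
        refine pathMean_mono fun l _ => ?_
        by_cases h : A.card ≤ 4 * (A ∩ vis 0 l).card
        · rw [if_pos h, if_pos (by omega)]
        · rw [if_neg h]
          split_ifs <;> norm_num
    _ ≤ _ := pathMean_hits_mul_le hk _ n' A 0 32 hμ
    _ ≤ _ := by
        refine pow_le_pow_left₀ (by positivity) ?_ _
        rw [div_le_div_iff₀ hk0 hm0, mul_assoc, div_mul_cancel₀ _ hm0.ne']
        linarith

lemma pathMean_card_vis_lt_le_window {n m F : ℕ} (hm : 1 ≤ m) (hF : 3 ≤ F) (hFn : 4 ^ F ≤ n)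
    (hlog : Real.log n ≤ 1024 * m ^ 10) :
    pathMean (32 * 4 ^ (F - 3)) (fun l => if (vis 0 l).card < 4 ^ F / m ^ 11 then 1 else 0) ≤
      (323584 / m : ℝ) ^ 32 := by
  have hm1 : (1 : ℝ) ≤ m := by exact_mod_cast hm
  have hm0 : (0 : ℝ) < m := by linarith
  refine (pathMean_card_vis_lt_pow _ _ _).trans ?_
  refine pow_le_pow_left₀ (pathMean_nonneg fun l _ => by split_ifs <;> norm_num) ?_ _
  refine (pathMean_card_vis_lt_le _ _).trans ?_
  have h1 : ((4 ^ F / m ^ 11 : ℕ) : ℝ) ≤ 64 * 4 ^ (F - 3) / m ^ 11 := by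
    refine Nat.cast_div_le.trans ?_
    obtain ⟨k, rfl⟩ := Nat.exists_eq_add_of_le hF
    push_cast
    rw [Nat.add_sub_cancel_left, pow_add]
    norm_num
  have h2 : Real.log ((4 ^ (F - 3) : ℕ) : ℝ) ≤ 1024 * m ^ 10 := by
    refine le_trans (Real.log_le_log (by positivity) ?_) hlog
    exact_mod_cast (Nat.pow_le_pow_right (by norm_num) (Nat.sub_le _ _)).trans hFn
  have h3 : (1 : ℝ) ≤ (m : ℝ) ^ 10 := one_le_pow₀ hm1
  have h4 : (0 : ℝ) ≤ Real.log ((4 ^ (F - 3) : ℕ) : ℝ) := Real.log_natCast_nonneg _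
  calc _ ≤ 64 * 4 ^ (F - 3) / m ^ 11 * (2051 * m ^ 10) / (4 ^ (F - 3) : ℝ) := by
        push_cast at h1 h2 h4 ⊢
        gcongr
        · linarith
        · linarith
    _ = 131264 / m := by
        field_simp
        norm_num
    _ ≤ _ := by gcongr; norm_num

open Classical in
lemma pathMean_bad_window_le_div {n m f : ℕ} (hm : 4 ≤ m) (hm' : 96 * m ^ 7 ≤ 2 ^ m)
    (hf : m ≤ f) (hF : 4 * 4 ^ (f + m) ≤ n) (hF' : n ≤ 16 * 4 ^ (m ^ 9) * 4 ^ (f + m))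
    (hlog : (m : ℝ) ^ 10 / 2 ≤ Real.log n) (hlog' : Real.log n ≤ 1024 * m ^ 10) (v : ℤ × ℤ) :
    pathMean n (fun l => if ¬ IsGoodWindow n m f l ∧ pos l = v then 1 else 0) ≤
      12 * (323584 / m : ℝ) ^ 32 / n := by
  have hm0 : (0 : ℝ) < m := by exact_mod_cast (by omega : 0 < m)
  have hs : 4 ^ (f + m) = 64 * 4 ^ (f + m - 3) := by
    rw [show (64 : ℕ) = 4 ^ 3 by norm_num, ← pow_add]
    congr 1
    omega
  have hs1 : 1 ≤ 4 ^ (f + m - 3) := Nat.one_le_pow _ _ (by norm_num)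
  have hr128 : 128 * m ^ 11 ≤ 4 ^ (f + m) := by
    calc 128 * m ^ 11 ≤ (96 * m ^ 7) ^ 4 := by
          have : m ^ 11 ≤ m ^ 28 := Nat.pow_le_pow_right (by omega) (by norm_num)
          ring_nf
          omega
      _ ≤ (2 ^ m) ^ 4 := Nat.pow_le_pow_left hm' _
      _ = 4 ^ (m + m) := by
          rw [show (4 : ℕ) = 2 ^ 2 by norm_num, ← pow_mul, ← pow_mul]
          congr 1
          omega
      _ ≤ 4 ^ (f + m) := Nat.pow_le_pow_right (by norm_num) (by omega)
  have hm11 : 0 < m ^ 11 := by positivity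
  have hr : 128 ≤ 4 ^ (f + m) / m ^ 11 := (Nat.le_div_iff_mul_le hm11).2 hr128
  have hrr : ((4 : ℝ) ^ (f + m)) ≤ 2 * m ^ 11 * (4 ^ (f + m) / m ^ 11 : ℕ) := by
    have h1 := Nat.lt_div_mul_add hm11 (a := 4 ^ (f + m))
    have h2 : m ^ 11 ≤ 4 ^ (f + m) / m ^ 11 * m ^ 11 := Nat.le_mul_of_pos_left _ (by omega)
    have h3 : 4 ^ (f + m) ≤ 2 * m ^ 11 * (4 ^ (f + m) / m ^ 11) := by nlinarith
    exact_mod_cast h3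
  have key := pathMean_bad_window_le (n := n) (m := m) (f := f) (a := n / 2)
    (b := n - 4 ^ (f + m) - n / 2) (u := 32 * 4 ^ (f + m - 3)) (r := 4 ^ (f + m) / m ^ 11)
    (ε := (323584 / m : ℝ) ^ 32) (δ := (323584 / m : ℝ) ^ 32) v (by omega) (by omega) (by omega)
    (by omega) ?_ ?_ ?_ ?_ (by positivity)
  · refine key.trans (le_of_eq ?_)
    ring
  · have : 4 ^ f * 4 ^ 4 ≤ 4 ^ (f + m) := by
      rw [← pow_add]
      exact Nat.pow_le_pow_right (by norm_num) (by omega)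
    omega
  · rw [Nat.le_div_iff_mul_le hm11]
    have h1 : (2 ^ (f + m) / m ^ 6) * m ^ 6 ≤ 2 ^ (f + m) := Nat.div_mul_le_self _ _
    calc _ = (2 ^ (f + m) / m ^ 6) ^ 2 * (2 * m ^ 11) := by ring
      _ ≤ (2 ^ (f + m) / m ^ 6) ^ 2 * (m * m ^ 11) := by gcongr; omega
      _ = ((2 ^ (f + m) / m ^ 6) * m ^ 6) ^ 2 := by ring
      _ ≤ (2 ^ (f + m)) ^ 2 := Nat.pow_le_pow_left h1 _
      _ = 4 ^ (f + m) := by rw [← pow_mul, mul_comm, pow_mul]; norm_num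
  · exact pathMean_card_vis_lt_le_window (by omega) (by omega) (by omega) hlog'
  · intro A hA hAu n' hn'
    refine pathMean_dense_le (by omega) (by omega) (hr.trans hA) (by omega) ?_ hlog hn'
    have hA0 : (0 : ℝ) < A.card := by exact_mod_cast (by omega : 0 < A.card)
    rw [div_le_iff₀ hA0]
    have h1 : (n : ℝ) ≤ 16 * 4 ^ (m ^ 9) * 4 ^ (f + m) := by exact_mod_cast hF'
    have h2 : ((4 ^ (f + m) / m ^ 11 : ℕ) : ℝ) ≤ A.card := by exact_mod_cast hA
    calc 2 * (n : ℝ) ≤ 2 * (16 * 4 ^ (m ^ 9) * (2 * m ^ 11 * A.card)) := by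
          refine mul_le_mul_of_nonneg_left (h1.trans ?_) (by norm_num)
          gcongr
          exact hrr.trans (by gcongr)
      _ = _ := by ring

lemma exists_window_params {n m : ℕ} (hm : 4 ≤ m) (hn0 : n ≠ 0)
    (h1 : m ^ 10 ≤ Nat.log 2 n) :
    ∃ f₀, m ≤ f₀ ∧ 4 * 4 ^ (f₀ + m ^ 9) ≤ n ∧ n ≤ 16 * 4 ^ (f₀ + m ^ 9) := by
  have hpow : 4 * m ^ 9 ≤ m ^ 10 := by
    rw [pow_succ m 9, mul_comm]
    exact Nat.mul_le_mul_left _ hm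
  have hm9 : 4 * m ≤ m ^ 9 := by
    calc 4 * m ≤ m ^ 8 * m := by
          gcongr
          exact hm.trans (Nat.le_self_pow (by norm_num) _)
      _ = m ^ 9 := by ring
  refine ⟨Nat.log 2 n / 2 - 1 - m ^ 9, by omega, ?_, ?_⟩
  · rw [Nat.sub_add_cancel (by omega)]
    calc 4 * 4 ^ (Nat.log 2 n / 2 - 1) = 2 ^ (2 * (Nat.log 2 n / 2)) := by
          rw [mul_comm, ← pow_succ, Nat.sub_add_cancel (by omega), pow_mul]
          norm_num
      _ ≤ 2 ^ Nat.log 2 n := Nat.pow_le_pow_right (by norm_num) (by omega)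
      _ ≤ n := Nat.pow_log_le_self 2 hn0
  · rw [Nat.sub_add_cancel (by omega)]
    calc n ≤ 2 ^ (Nat.log 2 n + 1) := (Nat.lt_pow_succ_log_self (by norm_num) n).le
      _ ≤ 2 ^ (2 * (Nat.log 2 n / 2 + 1)) := Nat.pow_le_pow_right (by norm_num) (by omega)
      _ = 4 ^ (Nat.log 2 n / 2 - 1 + 2) := by
          rw [pow_mul]
          congr 1
          omega
      _ = 16 * 4 ^ (Nat.log 2 n / 2 - 1) := by ring

lemma pathMean_val_le {n m : ℕ} (hm : 4 ≤ m) (hm' : 96 * m ^ 7 ≤ 2 ^ m) (hn0 : n ≠ 0)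
    (h1 : m ^ 10 ≤ Nat.log 2 n) (h2 : Nat.log 2 n < (m + 1) ^ 10) (x : (ℤ × ℤ) × ℤ) (R : ℕ) :
    pathMean n (fun l => val x R ∅ 0 0 l) ≤
      (12 * m ^ 8 * (323584 / m : ℝ) ^ 32 +
        ((1 - 1 / (96 * m ^ 6)) ^ m ^ 8 + m ^ 8 * (8 * (1 / 2) ^ m))) / n := by
  classical
  obtain ⟨f₀, hf₀, hfn, hnf⟩ := exists_window_params hm hn0 h1
  have hm1 : (1 : ℝ) ≤ m := by exact_mod_cast (by omega : 1 ≤ m)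
  have hm0 : (0 : ℝ) < m := by linarith
  have hn1 : (0 : ℝ) < n := by exact_mod_cast Nat.pos_of_ne_zero hn0
  have hlog : (m : ℝ) ^ 10 / 2 ≤ Real.log n := by
    have h3 : ((2 : ℝ) ^ Nat.log 2 n) ≤ n := by exact_mod_cast Nat.pow_log_le_self 2 hn0
    have h4 := Real.log_le_log (by positivity) h3
    rw [Real.log_pow] at h4
    have h5 : (m : ℝ) ^ 10 ≤ Nat.log 2 n := by exact_mod_cast h1
    have := Real.log_two_gt_d9
    nlinarith
  have hlog' : Real.log n ≤ 1024 * (m : ℝ) ^ 10 := by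
    have h3 : (n : ℝ) ≤ 2 ^ (Nat.log 2 n + 1) := by
      exact_mod_cast (Nat.lt_pow_succ_log_self (by norm_num) n).le
    have h4 := Real.log_le_log hn1 h3
    rw [Real.log_pow] at h4
    have h5 : ((Nat.log 2 n + 1 : ℕ) : ℝ) ≤ ((m : ℝ) + 1) ^ 10 := by exact_mod_cast h2
    have h6 : ((m : ℝ) + 1) ^ 10 ≤ (2 * m) ^ 10 := by gcongr; linarith
    have := Real.log_two_lt_d9
    have := Real.log_nonneg (show (1 : ℝ) ≤ 2 by norm_num)
    calc _ ≤ _ := h4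
      _ ≤ ((Nat.log 2 n + 1 : ℕ) : ℝ) * 1 := by gcongr; linarith
      _ ≤ (2 * m : ℝ) ^ 10 := by linarith
      _ = _ := by ring
  set B : ℝ := (1 - 1 / (96 * m ^ 6)) ^ m ^ 8 + m ^ 8 * (8 * (1 / 2) ^ m) with hB
  have hB0 : 0 ≤ B := by
    have : (1 : ℝ) / (96 * m ^ 6) ≤ 1 := by
      rw [div_le_one (by positivity)]
      have : (1 : ℝ) ≤ (m : ℝ) ^ 6 := one_le_pow₀ hm1
      linarith
    have h0 : (0 : ℝ) ≤ 1 - 1 / (96 * m ^ 6) := by linarith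
    positivity
  have hJ : m ^ 8 * m = m ^ 9 := by ring
  have hpt : ∀ l : List (Bool × Bool), l.length = n → val x R ∅ 0 0 l ≤
      (∑ j ∈ Finset.range (m ^ 8),
        if ¬ IsGoodWindow n m (f₀ + j * m) l ∧ pos l = x.1 then 1 else 0) +
        (if pos l = x.1 then 1 else 0) * B := by
    intro l hl
    have hs0 : ∀ j ∈ Finset.range (m ^ 8), (0 : ℝ) ≤
        if ¬ IsGoodWindow n m (f₀ + j * m) l ∧ pos l = x.1 then 1 else 0 :=
      fun j _ => by split_ifs <;> norm_num
    by_cases hx : pos l = x.1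
    · by_cases hgood : ∀ j < m ^ 8, IsGoodWindow n m (f₀ + j * m) l
      · have := val_le_of_good (x := x) (by omega) hm' hf₀ hl hgood (by rw [hJ]; omega) R
        have h0 := Finset.sum_nonneg hs0
        rw [if_pos hx, one_mul, hB]
        push_cast at this
        linarith
      · push Not at hgood
        obtain ⟨j, hj, hbad⟩ := hgood
        have h3 := Finset.single_le_sum hs0 (Finset.mem_range.2 hj)
        rw [if_pos ⟨hbad, hx⟩] at h3
        have h4 : 0 ≤ (if pos l = x.1 then 1 else 0) * B := by
          rw [if_pos hx, one_mul]
          exact hB0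
        linarith [(val_le_one : val x R ∅ 0 0 l ≤ 1)]
    · rw [val_eq_zero (by rwa [zero_add])]
      have h0 := Finset.sum_nonneg hs0
      rw [if_neg hx]
      linarith
  refine (pathMean_mono hpt).trans ?_
  rw [pathMean_add, pathMean_sum, pathMean_mul_const, add_div]
  refine add_le_add ?_ ?_
  · calc _ ≤ ∑ j ∈ Finset.range (m ^ 8), 12 * (323584 / m : ℝ) ^ 32 / n := by
          refine Finset.sum_le_sum fun j hj => ?_
          have hj' : j + 1 ≤ m ^ 8 := Finset.mem_range.1 hj
          have hjm : (j + 1) * m ≤ m ^ 9 := by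
            rw [← hJ]
            exact Nat.mul_le_mul_right _ hj'
          have hjm' : f₀ + j * m + m ≤ f₀ + m ^ 9 := by linarith
          refine pathMean_bad_window_le_div hm hm' (by omega) ?_ ?_ hlog hlog' _
          · exact (Nat.mul_le_mul_left 4 (Nat.pow_le_pow_right (by norm_num) hjm')).trans hfn
          · refine hnf.trans ?_
            rw [mul_assoc, ← pow_add]
            exact Nat.mul_le_mul_left 16 (Nat.pow_le_pow_right (by norm_num) (by omega))
      _ = _ := by
          rw [Finset.sum_const, Finset.card_range, nsmul_eq_mul]
          push_cast
          ring
  · rw [pathMean_pos_eq]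
    calc _ ≤ 1 / (n : ℝ) * B := by
          gcongr
          exact planeProb_le (Nat.pos_of_ne_zero hn0) _
      _ = B / n := by ring

lemma eventually_window_bound : ∃ D : ℝ, 0 ≤ D ∧ ∀ᶠ m : ℕ in atTop,
    12 * m ^ 8 * (323584 / m : ℝ) ^ 32 +
      ((1 - 1 / (96 * m ^ 6)) ^ m ^ 8 + m ^ 8 * (8 * (1 / 2) ^ m)) ≤ D / ((m : ℝ) + 1) ^ 20 := by
  refine ⟨(12 * 323584 ^ 32 + 2) * 2 ^ 20, by positivity, ?_⟩
  have t1 := tendsto_pow_const_mul_const_pow_of_abs_lt_one 20 (r := Real.exp (-1))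
    (by rw [abs_of_pos (Real.exp_pos _)]; exact Real.exp_lt_one_iff.mpr (by norm_num))
  have t2 := tendsto_pow_const_mul_const_pow_of_abs_lt_one 28 (r := (1 / 2 : ℝ))
    (by rw [abs_of_pos (by norm_num)]; norm_num)
  filter_upwards [t1.eventually (eventually_le_nhds (show (0 : ℝ) < 1 by norm_num)),
    t2.eventually (eventually_le_nhds (show (0 : ℝ) < 1 / 8 by norm_num)),
    eventually_ge_atTop 96] with m h1 h2 hm
  have hm1 : (96 : ℝ) ≤ m := by exact_mod_cast hm
  have hm0 : (0 : ℝ) < m := by linarith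
  have e1 : 12 * (m : ℝ) ^ 8 * (323584 / m : ℝ) ^ 32 ≤ 12 * 323584 ^ 32 / m ^ 20 := by
    rw [le_div_iff₀ (by positivity), div_pow]
    have : (12 : ℝ) * m ^ 8 * (323584 ^ 32 / m ^ 32) * m ^ 20 = 12 * 323584 ^ 32 / m ^ 4 := by
      field_simp
    rw [this]
    exact div_le_self (by positivity) (one_le_pow₀ (by linarith))
  have e2 : (1 - 1 / (96 * (m : ℝ) ^ 6)) ^ m ^ 8 ≤ 1 / m ^ 20 := by
    rw [le_div_iff₀ (by positivity)]
    refine le_trans ?_ h1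
    rw [mul_comm]
    refine mul_le_mul_of_nonneg_left ?_ (by positivity)
    have h3 := Real.one_sub_le_exp_neg (1 / (96 * (m : ℝ) ^ 6))
    have h4 : (0 : ℝ) ≤ 1 - 1 / (96 * (m : ℝ) ^ 6) := by
      rw [sub_nonneg, div_le_one (by positivity)]
      have : (1 : ℝ) ≤ (m : ℝ) ^ 6 := one_le_pow₀ (by linarith)
      linarith
    refine (pow_le_pow_left₀ h4 h3 _).trans ?_
    rw [← Real.exp_nat_mul, ← Real.exp_nat_mul, Real.exp_le_exp]
    push_cast
    have : (m : ℝ) ^ 8 * -(1 / (96 * (m : ℝ) ^ 6)) = - (m * (m / 96)) := by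
      field_simp
    rw [this]
    have : 1 ≤ (m : ℝ) / 96 := by linarith
    nlinarith
  have e3 : (m : ℝ) ^ 8 * (8 * (1 / 2) ^ m) ≤ 1 / m ^ 20 := by
    rw [le_div_iff₀ (by positivity)]
    calc _ = 8 * ((m : ℝ) ^ 28 * (1 / 2) ^ m) := by ring
      _ ≤ 1 := by linarith
  calc _ ≤ (12 * 323584 ^ 32 + 2) / (m : ℝ) ^ 20 := by
        rw [add_div, show (2 : ℝ) / (m : ℝ) ^ 20 = 1 / m ^ 20 + 1 / m ^ 20 by ring]
        linarith
    _ ≤ _ := by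
        rw [div_le_div_iff₀ (by positivity) (by positivity), mul_assoc, ← mul_pow]
        gcongr
        linarith

lemma eventually_mul_pow_le_two_pow : ∀ᶠ m : ℕ in atTop, 96 * m ^ 7 ≤ 2 ^ m := by
  have t := tendsto_pow_const_mul_const_pow_of_abs_lt_one 7 (r := (1 / 2 : ℝ))
    (by rw [abs_of_pos (by norm_num)]; norm_num)
  filter_upwards [t.eventually (eventually_le_nhds (show (0 : ℝ) < 1 / 96 by norm_num))] with m h
  rw [one_div_pow, mul_one_div, div_le_iff₀ (by positivity)] at h
  have : (96 : ℝ) * m ^ 7 ≤ 2 ^ m := by linarith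
  exact_mod_cast this

lemma summable_one_div_mul_log_sq :
    Summable fun n : ℕ => 1 / ((n : ℝ) * ((Nat.log 2 n : ℝ) + 1) ^ 2) := by
  rw [← summable_condensed_iff_of_nonneg (fun n => by positivity) fun a b ha hab => ?_]
  · have h := (summable_nat_add_iff 1).2 (Real.summable_one_div_nat_pow.2 (one_lt_two))
    refine h.congr fun k => ?_
    rw [Nat.log_pow (by norm_num)]
    push_cast
    field_simp
  · have ha' : (0 : ℝ) < a := by exact_mod_cast ha
    have hl : (Nat.log 2 a : ℝ) ≤ Nat.log 2 b := by exact_mod_cast Nat.log_mono_right hab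
    have hab' : (a : ℝ) ≤ b := by exact_mod_cast hab
    gcongr

/-- The probability that the walk returns to `x` with its `n`-th step from an old site is summable
in `n`. -/
theorem exists_summable_pathMean_val_le : ∃ r : ℕ → ℝ, Summable r ∧ (∀ n, 0 ≤ r n) ∧
    ∀ n x R, pathMean n (fun l => val x R ∅ 0 0 l) ≤ r n := by
  obtain ⟨D, hD, hev⟩ := eventually_window_bound
  obtain ⟨m₀, hm₀⟩ := eventually_atTop.1
    ((hev.and eventually_mul_pow_le_two_pow).and (eventually_ge_atTop 4))
  let r : ℕ → ℝ := fun n => D * (1 / ((n : ℝ) * ((Nat.log 2 n : ℝ) + 1) ^ 2)) +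
    if n < 2 ^ m₀ ^ 10 then 1 else 0
  have hr0 : ∀ n : ℕ, 0 ≤ D * (1 / ((n : ℝ) * ((Nat.log 2 n : ℝ) + 1) ^ 2)) :=
    fun n => by positivity
  refine ⟨r, ?_, fun n => ?_, fun n x R => ?_⟩
  · refine (summable_one_div_mul_log_sq.mul_left D).add ?_
    refine summable_of_ne_finset_zero (s := Finset.range (2 ^ m₀ ^ 10)) fun n hn => ?_
    rw [if_neg (by simpa using hn)]
  · refine add_nonneg (hr0 n) ?_
    split_ifs <;> norm_num
  · by_cases hn : n < 2 ^ m₀ ^ 10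
    · have h1 : pathMean n (fun l => val x R ∅ 0 0 l) ≤ 1 :=
        pathMean_le_const fun l _ => val_le_one
      have h2 := hr0 n
      simp only [r, if_pos hn]
      linarith
    · have hn' : 2 ^ m₀ ^ 10 ≤ n := not_lt.1 hn
      have hn0 : n ≠ 0 := by
        have : 1 ≤ 2 ^ m₀ ^ 10 := Nat.one_le_two_pow
        omega
      have hlog : m₀ ^ 10 ≤ Nat.log 2 n := Nat.le_log_of_pow_le (by norm_num) hn'
      obtain ⟨m, hm0, hm1, hm2⟩ : ∃ m, m₀ ≤ m ∧ m ^ 10 ≤ Nat.log 2 n ∧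
          Nat.log 2 n < (m + 1) ^ 10 := by
        have hb : ∃ k, Nat.log 2 n < (k + 1) ^ 10 :=
          ⟨Nat.log 2 n, (Nat.lt_succ_self _).trans_le (Nat.le_self_pow (by norm_num) _)⟩
        classical
        refine ⟨Nat.find hb, ?_, ?_, Nat.find_spec hb⟩
        · by_contra! h
          have := Nat.find_spec hb
          have h3 : (Nat.find hb + 1) ^ 10 ≤ m₀ ^ 10 := Nat.pow_le_pow_left h _
          omega
        · rcases Nat.eq_zero_or_pos (Nat.find hb) with h | h
          · rw [h]; simp
          · have := Nat.find_min hb (Nat.sub_lt h one_pos)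
            rw [Nat.sub_add_cancel (show 1 ≤ Nat.find hb from h)] at this
            exact not_lt.1 this
      obtain ⟨⟨hA, hB⟩, hC⟩ := hm₀ m hm0
      have h3 := pathMean_val_le hC hB hn0 hm1 hm2 x R
      simp only [r, if_neg hn, add_zero]
      have hn1 : (0 : ℝ) < n := by exact_mod_cast Nat.pos_of_ne_zero hn0
      have hl : (Nat.log 2 n : ℝ) + 1 ≤ ((m : ℝ) + 1) ^ 10 := by exact_mod_cast hm2
      calc _ ≤ _ := h3
        _ ≤ D / ((m : ℝ) + 1) ^ 20 / n := by gcongr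
        _ ≤ D / ((Nat.log 2 n : ℝ) + 1) ^ 2 / n := by
            gcongr
            calc ((Nat.log 2 n : ℝ) + 1) ^ 2 ≤ (((m : ℝ) + 1) ^ 10) ^ 2 := by gcongr
              _ = _ := by ring
        _ = _ := by
            field_simp

/-- Coordinates on `ℤ³` in which the planar steps are `(±1, ±1)`. -/
def rot (s : Fin 3 → ℤ) : (ℤ × ℤ) × ℤ := ((s 1 + s 2, s 1 - s 2), s 0)

lemma rot_injective : Function.Injective rot := by
  intro s t h
  simp only [rot, Prod.mk.injEq] at h
  obtain ⟨⟨h1, h2⟩, h3⟩ := h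
  ext i
  fin_cases i
  · exact h3
  · change s 1 = t 1
    omega
  · change s 2 = t 2
    omega

/-- The step of the walk encoded by a pair of signs. -/
def planeStep (a : Bool × Bool) : Fin 3 → ℤ :=
  sgn a.1 • unitVec 3 (if a.1 = a.2 then 1 else 2)

/-- The step of the walk from a new site encoded by a sign. -/
def lineStep (b : Bool) : Fin 3 → ℤ := sgn b • unitVec 3 0

lemma rot_add_planeStep (s : Fin 3 → ℤ) (a : Bool × Bool) :
    rot (s + planeStep a) = ((rot s).1 + dvec a, (rot s).2) := by
  obtain ⟨a, b⟩ := a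
  cases a <;> cases b <;> simp [rot, planeStep, unitVec, sgn, dvec] <;> constructor <;> ring

lemma rot_add_lineStep (s : Fin 3 → ℤ) (b : Bool) :
    rot (s + lineStep b) = ((rot s).1, (rot s).2 + sgn b) := by
  simp [rot, lineStep, unitVec]

lemma sgn_injective : Function.Injective sgn := by
  intro a b
  cases a <;> cases b <;> simp [sgn]

lemma planeStep_injective : Function.Injective planeStep := by
  intro a b h
  have h1 := rot_add_planeStep 0 a
  rw [h, rot_add_planeStep] at h1
  simp only [dvec, add_right_inj, and_true, Prod.ext_iff] at h1
  exact (Prod.ext (sgn_injective h1.1) (sgn_injective h1.2)).symm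

lemma lineStep_injective : Function.Injective lineStep := by
  intro a b h
  have h1 := rot_add_lineStep 0 a
  rw [h, rot_add_lineStep] at h1
  simp only [Prod.mk.injEq, add_right_inj, true_and] at h1
  exact (sgn_injective h1).symm

/-- The trajectory is at an old site at time `n`. -/
def IsOld (T : ℕ → Fin 3 → ℤ) (n : ℕ) : Prop := ∃ k < n, T n = T k

open Classical in
/-- The trajectory, started at time `n` and observed during `R` steps, is at `x` at its `k`-th later
time at an old site. -/
def HitsAtOld (x : (ℤ × ℤ) × ℤ) (T : ℕ → Fin 3 → ℤ) : ℕ → ℕ → ℕ → Prop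
  | 0, _, _ => False
  | R + 1, n, k =>
    if IsOld T n then
      match k with
      | 0 => rot (T n) = x
      | k + 1 => HitsAtOld x T R (n + 1) k
    else HitsAtOld x T R (n + 1) k

section HitsAtOld
variable {x : (ℤ × ℤ) × ℤ} {T : ℕ → Fin 3 → ℤ} {R n k : ℕ}

lemma hitsAtOld_old_zero (h : IsOld T n) :
    HitsAtOld x T (R + 1) n 0 ↔ rot (T n) = x := by
  simp [HitsAtOld, h]

lemma hitsAtOld_old_succ (h : IsOld T n) :
    HitsAtOld x T (R + 1) n (k + 1) ↔ HitsAtOld x T R (n + 1) k := by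
  simp [HitsAtOld, h]

lemma hitsAtOld_new (h : ¬ IsOld T n) :
    HitsAtOld x T (R + 1) n k ↔ HitsAtOld x T R (n + 1) k := by
  simp [HitsAtOld, h]

lemma HitsAtOld.succ (h : HitsAtOld x T R n k) : HitsAtOld x T (R + 1) n k := by
  induction R generalizing n k with
  | zero => exact h.elim
  | succ R ih =>
    by_cases ho : IsOld T n
    · cases k with
      | zero => rwa [hitsAtOld_old_zero ho] at h ⊢
      | succ k =>
        rw [hitsAtOld_old_succ ho] at h ⊢
        exact ih h
    · rw [hitsAtOld_new ho] at h ⊢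
      exact ih h

open Classical in
lemma hitsAtOld_count (h : IsOld T (n + R)) (hx : rot (T (n + R)) = x) :
    HitsAtOld x T (R + 1) n (Nat.count (fun j => IsOld T (n + j)) R) := by
  induction R generalizing n with
  | zero => exact (hitsAtOld_old_zero h).2 hx
  | succ R ih =>
    have e : n + (R + 1) = n + 1 + R := by ring
    have := ih (n := n + 1) (by rwa [← e]) (by rwa [← e])
    rw [Nat.count_succ']
    simp only [add_zero]
    have e2 : (fun k => IsOld T (n + (k + 1))) = fun k => IsOld T (n + 1 + k) := by
      ext k
      rw [show n + (k + 1) = n + 1 + k by ring]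
    simp only [e2]
    by_cases ho : IsOld T n
    · rw [if_pos ho]
      exact (hitsAtOld_old_succ ho).2 this
    · rw [if_neg ho]
      exact (hitsAtOld_new ho).2 this

end HitsAtOld

lemma frequently_hitsAtOld {T : ℕ → Fin 3 → ℤ} {s : Fin 3 → ℤ} (h : {n | T n = s}.Infinite) :
    ∃ᶠ k in atTop, ∃ R, HitsAtOld (rot s) T R 0 k := by
  classical
  obtain ⟨n₀, hn₀⟩ := h.nonempty
  have h1 : ({n | T n = s} \ Set.Iic n₀).Infinite := h.sdiff (Set.finite_Iic n₀)
  have hold : ∀ n ∈ {n | T n = s} \ Set.Iic n₀, IsOld T n := fun n hn =>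
    ⟨n₀, not_le.1 hn.2, hn.1.trans hn₀.symm⟩
  have hinj : Set.InjOn (Nat.count (IsOld T)) ({n | T n = s} \ Set.Iic n₀) := by
    intro a ha b hb hab
    rcases lt_trichotomy a b with hlt | heq | hlt
    · exact absurd hab (Nat.count_strict_mono (hold a ha) hlt).ne
    · exact heq
    · exact absurd hab (Nat.count_strict_mono (hold b hb) hlt).ne'
  rw [Nat.frequently_atTop_iff_infinite]
  refine (h1.image hinj).mono ?_
  rintro _ ⟨n, hn, rfl⟩
  refine ⟨n + 1, ?_⟩
  have := hitsAtOld_count (x := rot s) (T := T) (n := 0) (R := n)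
    (by rw [zero_add]; exact hold n hn) (by rw [zero_add]; exact congrArg rot hn.1)
  simpa only [zero_add] using this

/-- The event that the trajectory agrees with `h` up to time `n`. -/
def cyl {Ω : Type*} (S : ℕ → Ω → Fin 3 → ℤ) (n : ℕ) (h : ℕ → Fin 3 → ℤ) : Set Ω :=
  {ω | ∀ k ≤ n, S k ω = h k}

/-- The sites visited by `h` before time `n`. -/
def sites (n : ℕ) (h : ℕ → Fin 3 → ℤ) : Finset ((ℤ × ℤ) × ℤ) :=
  (Finset.range n).image fun k => rot (h k)

lemma rot_mem_sites {n : ℕ} {h : ℕ → Fin 3 → ℤ} : rot (h n) ∈ sites n h ↔ IsOld h n := by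
  simp [sites, IsOld, rot_injective.eq_iff, eq_comm]

lemma sites_succ_update (n : ℕ) (h : ℕ → Fin 3 → ℤ) (s : Fin 3 → ℤ) :
    sites (n + 1) (Function.update h (n + 1) s) = insert (rot (h n)) (sites n h) := by
  rw [sites, Finset.range_add_one, Finset.image_insert, Function.update_of_ne (by omega)]
  congr 1
  refine Finset.image_congr fun k hk => ?_
  have : k < n := by simpa using hk
  simp only [Function.update_of_ne (show k ≠ n + 1 by omega)]

section cyl
variable {Ω : Type*} {S : ℕ → Ω → Fin 3 → ℤ}

lemma cyl_succ_update (n : ℕ) (h : ℕ → Fin 3 → ℤ) (s : Fin 3 → ℤ) :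
    cyl S (n + 1) (Function.update h (n + 1) s) =
      {ω | (∀ k ≤ n, S k ω = h k) ∧ S (n + 1) ω = s} := by
  ext ω
  constructor
  · intro hω
    refine ⟨fun k hk => ?_, ?_⟩
    · have := hω k (by omega)
      rwa [Function.update_of_ne (by omega)] at this
    · simpa using hω (n + 1) le_rfl
  · rintro ⟨h1, h2⟩ k hk
    rcases Nat.lt_or_ge n k with hlt | hge
    · obtain rfl : k = n + 1 := by omega
      simpa using h2
    · rw [Function.update_of_ne (by omega)]
      exact h1 k hge

lemma isOld_iff_of_mem_cyl {n : ℕ} {h : ℕ → Fin 3 → ℤ} {ω : Ω} (hω : ω ∈ cyl S n h) :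
    IsOld (fun k => S k ω) n ↔ IsOld h n := by
  refine exists_congr fun k => and_congr_right fun hk => ?_
  simp only [hω n le_rfl, hω k hk.le]

variable [MeasurableSpace Ω] {P : Measure Ω}

lemma measurableSet_cyl (hS : ∀ n, Measurable (S n)) (n : ℕ) (h : ℕ → Fin 3 → ℤ) :
    MeasurableSet (cyl S n h) := by
  have : cyl S n h = ⋂ k, ⋂ (_ : k ≤ n), S k ⁻¹' {h k} := by
    ext ω
    simp [cyl]
  rw [this]
  exact MeasurableSet.iInter fun k => MeasurableSet.iInter fun _ =>
    hS k (measurableSet_singleton _)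

/-- If finitely many equally likely steps exhaust the conditional probability, events can be bounded
step by step. -/
lemma measure_cyl_inter_le [IsProbabilityMeasure P] {ι : Type*} [Fintype ι] [Nonempty ι]
    (hS : ∀ n, Measurable (S n))
    (n : ℕ) (h : ℕ → Fin 3 → ℤ) {step : ι → Fin 3 → ℤ} (hstep : Function.Injective step)
    (hP : ∀ i, P (cyl S (n + 1) (Function.update h (n + 1) (h n + step i))) =
      P (cyl S n h) / Fintype.card ι) (H : Set Ω) {b : ι → ℝ} (hb : ∀ i, 0 ≤ b i)
    (hH : ∀ i, P (cyl S (n + 1) (Function.update h (n + 1) (h n + step i)) ∩ H) ≤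
      P (cyl S (n + 1) (Function.update h (n + 1) (h n + step i))) * ENNReal.ofReal (b i)) :
    P (cyl S n h ∩ H) ≤ P (cyl S n h) * ENNReal.ofReal ((∑ i, b i) / Fintype.card ι) := by
  set E : ι → Set Ω := fun i => cyl S (n + 1) (Function.update h (n + 1) (h n + step i)) with hE
  have hcard : (Fintype.card ι : ENNReal) ≠ 0 := by simp
  have hmeas : ∀ i, MeasurableSet (E i) := fun i => measurableSet_cyl hS _ _
  have hsub : (⋃ i, E i) ⊆ cyl S n h := by
    refine Set.iUnion_subset fun i ω hω => ?_
    simp only [hE, cyl_succ_update] at hω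
    exact hω.1
  have hdisj : Pairwise (Function.onFun Disjoint E) := by
    intro i j hij
    refine Set.disjoint_left.2 fun ω h1 h2 => hij ?_
    simp only [hE, cyl_succ_update] at h1 h2
    exact hstep (add_left_cancel (h1.2.symm.trans h2.2))
  have hfull : P (⋃ i, E i) = P (cyl S n h) := by
    rw [measure_iUnion hdisj hmeas, tsum_fintype]
    simp only [hE, hP, Finset.sum_const, Finset.card_univ, nsmul_eq_mul]
    exact ENNReal.mul_div_cancel hcard (ENNReal.natCast_ne_top _)
  have hnull : P (cyl S n h \ ⋃ i, E i) = 0 := by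
    rw [measure_sdiff hsub (MeasurableSet.iUnion hmeas).nullMeasurableSet (measure_ne_top _ _),
      hfull, tsub_self]
  calc P (cyl S n h ∩ H) ≤ P ((cyl S n h \ ⋃ i, E i) ∪ ⋃ i, (E i ∩ H)) := by
        refine measure_mono fun ω hω => ?_
        by_cases hi : ω ∈ ⋃ i, E i
        · obtain ⟨i, hi⟩ := Set.mem_iUnion.1 hi
          exact Or.inr (Set.mem_iUnion.2 ⟨i, hi, hω.2⟩)
        · exact Or.inl ⟨hω.1, hi⟩
    _ ≤ 0 + ∑ i, P (E i ∩ H) := by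
        refine (measure_union_le _ _).trans ?_
        rw [hnull]
        gcongr
        exact measure_iUnion_fintype_le _ _
    _ ≤ ∑ i, P (cyl S n h) / Fintype.card ι * ENNReal.ofReal (b i) := by
        rw [zero_add]
        refine Finset.sum_le_sum fun i _ => ?_
        rw [← hP i]
        exact hH i
    _ = _ := by
        rw [← Finset.mul_sum, ← ENNReal.ofReal_sum_of_nonneg fun i _ => hb i,
          ENNReal.ofReal_div_of_pos (by exact_mod_cast Fintype.card_pos), ENNReal.ofReal_natCast]
        simp only [div_eq_mul_inv]
        ring

lemma measure_cyl_planeStep (hS : IsBERW 3 1 2 P S) {n : ℕ} {h : ℕ → Fin 3 → ℤ}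
    (ho : IsOld h n) (a : Bool × Bool) :
    P (cyl S (n + 1) (Function.update h (n + 1) (h n + planeStep a))) =
      P (cyl S n h) / Fintype.card (Bool × Bool) := by
  have key := hS.2.2.2 n h ho (if a.1 = a.2 then 1 else 2) (by split_ifs <;> decide) (sgn a.1)
    (by cases a.1 <;> simp [sgn])
  rw [cyl_succ_update, planeStep, key]
  norm_num [cyl]

lemma measure_cyl_lineStep (hS : IsBERW 3 1 2 P S) {n : ℕ} {h : ℕ → Fin 3 → ℤ}
    (ho : ¬ IsOld h n) (b : Bool) :
    P (cyl S (n + 1) (Function.update h (n + 1) (h n + lineStep b))) =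
      P (cyl S n h) / Fintype.card Bool := by
  have key := hS.2.2.1 n h (fun k hk e => ho ⟨k, hk, e⟩) 0 (by decide) (sgn b)
    (by cases b <;> simp [sgn])
  rw [cyl_succ_update, lineStep, key]
  norm_num [cyl]

lemma measure_cyl_inter_hitsAtOld_le [IsProbabilityMeasure P] (hS : IsBERW 3 1 2 P S)
    (x : (ℤ × ℤ) × ℤ) (R n k : ℕ)
    (h : ℕ → Fin 3 → ℤ) :
    P (cyl S n h ∩ {ω | HitsAtOld x (fun j => S j ω) R n k}) ≤ P (cyl S n h) *
      ENNReal.ofReal (pathMean k fun l => val x R (sites n h) (rot (h n)).1 (rot (h n)).2 l) := by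
  induction R generalizing n k h with
  | zero => simp [HitsAtOld]
  | succ R ih =>
    have hih : ∀ k s, P (cyl S (n + 1) (Function.update h (n + 1) s) ∩
        {ω | HitsAtOld x (fun j => S j ω) R (n + 1) k}) ≤
        P (cyl S (n + 1) (Function.update h (n + 1) s)) * ENNReal.ofReal (pathMean k fun l =>
          val x R (insert (rot (h n)) (sites n h)) (rot s).1 (rot s).2 l) := fun k s => by
      have := ih (n + 1) k (Function.update h (n + 1) s)
      rwa [sites_succ_update, Function.update_self] at this
    by_cases ho : IsOld h n
    · have hmem := rot_mem_sites.2 ho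
      cases k with
      | zero =>
        by_cases hx : rot (h n) = x
        · simp only [pathMean]
          rw [val_old_nil (by exact hmem), if_pos hx, ENNReal.ofReal_one, mul_one]
          exact measure_mono Set.inter_subset_left
        · have : cyl S n h ∩ {ω | HitsAtOld x (fun j => S j ω) (R + 1) n 0} = ∅ := by
            rw [Set.eq_empty_iff_forall_notMem]
            rintro ω ⟨h1, h2⟩
            rw [Set.mem_ofPred_eq, hitsAtOld_old_zero ((isOld_iff_of_mem_cyl h1).2 ho),
              h1 n le_rfl] at h2
            exact hx h2
          rw [this, measure_empty]
          exact zero_le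
      | succ k =>
        have hset : cyl S n h ∩ {ω | HitsAtOld x (fun j => S j ω) (R + 1) n (k + 1)} =
            cyl S n h ∩ {ω | HitsAtOld x (fun j => S j ω) R (n + 1) k} := by
          ext ω
          refine and_congr_right fun h1 => ?_
          exact hitsAtOld_old_succ ((isOld_iff_of_mem_cyl h1).2 ho)
        rw [hset]
        refine (measure_cyl_inter_le hS.1 n h planeStep_injective (measure_cyl_planeStep hS ho) _
          (fun a => pathMean_nonneg fun l _ => val_nonneg)
          fun a => hih k (h n + planeStep a)).trans (le_of_eq ?_)
        simp only [pathMean, rot_add_planeStep, Finset.insert_eq_of_mem hmem]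
        congr 3
        · refine Finset.sum_congr rfl fun a _ => pathMean_congr fun l _ => ?_
          exact (val_old_cons (by exact hmem) a).symm
    · have hmem : ((rot (h n)).1, (rot (h n)).2) ∉ sites n h := fun hc => ho (rot_mem_sites.1 hc)
      have hset : cyl S n h ∩ {ω | HitsAtOld x (fun j => S j ω) (R + 1) n k} =
          cyl S n h ∩ {ω | HitsAtOld x (fun j => S j ω) R (n + 1) k} := by
        ext ω
        refine and_congr_right fun h1 => ?_
        exact hitsAtOld_new (mt (isOld_iff_of_mem_cyl h1).1 ho)
      rw [hset]
      refine (measure_cyl_inter_le hS.1 n h lineStep_injective (measure_cyl_lineStep hS ho) _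
        (fun b => pathMean_nonneg fun l _ => val_nonneg)
        fun b => hih k (h n + lineStep b)).trans (le_of_eq ?_)
      simp only [val_new hmem, pathMean_div_const, pathMean_add, rot_add_lineStep,
        Fintype.sum_bool, Fintype.card_bool, sgn, if_true, Bool.false_eq_true, if_false,
        Prod.mk.eta, Nat.cast_ofNat, sub_eq_add_neg]

lemma measure_exists_hitsAtOld_le [IsProbabilityMeasure P] (hS : IsBERW 3 1 2 P S)
    {x : (ℤ × ℤ) × ℤ} {k : ℕ} {c : ℝ}
    (hc : ∀ R, pathMean k (fun l => val x R ∅ 0 0 l) ≤ c) :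
    P {ω | ∃ R, HitsAtOld x (fun j => S j ω) R 0 k} ≤ ENNReal.ofReal c := by
  have hmono : Monotone fun R => {ω | HitsAtOld x (fun j => S j ω) R 0 k} :=
    monotone_nat_of_le_succ fun R ω hω => HitsAtOld.succ hω
  rw [Set.ofPred_exists, hmono.measure_iUnion]
  refine iSup_le fun R => ?_
  have h0 : P (cyl S 0 fun _ => 0)ᶜ = 0 := by
    have : (cyl S 0 fun _ => 0)ᶜ = {ω | ¬ S 0 ω = 0} := by
      ext ω
      simp [cyl]
    rw [this]
    exact ae_iff.1 hS.2.1
  calc _ ≤ P ((cyl S 0 fun _ => 0) ∩ {ω | HitsAtOld x (fun j => S j ω) R 0 k} ∪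
          (cyl S 0 fun _ => 0)ᶜ) := by
        refine measure_mono fun ω hω => ?_
        by_cases h1 : ω ∈ cyl S 0 fun _ => 0
        · exact Or.inl ⟨h1, hω⟩
        · exact Or.inr h1
    _ ≤ _ := measure_union_le _ _
    _ ≤ 1 * ENNReal.ofReal c := by
        rw [h0, add_zero]
        refine (measure_cyl_inter_hitsAtOld_le hS x R 0 k fun _ => 0).trans ?_
        refine mul_le_mul' prob_le_one (ENNReal.ofReal_le_ofReal ?_)
        exact hc R
    _ = _ := one_mul _

end cyl

end BERW

/-- The `M₃(1,2)` balanced excited random walk on `ℤ³` is transient. -/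
theorem berw_M3_1_2_transient {Ω : Type*} [MeasurableSpace Ω]
    (P : Measure Ω) [IsProbabilityMeasure P]
    (S : ℕ → Ω → Fin 3 → ℤ) (hS : IsBERW 3 1 2 P S) :
    IsTransientWalk 3 P S := by
  obtain ⟨r, hr, hr0, hle⟩ := BERW.exists_summable_pathMean_val_le
  rw [IsTransientWalk, ae_all_iff]
  intro s
  have hsum : ∑' k, P {ω | ∃ R, BERW.HitsAtOld (BERW.rot s) (fun j => S j ω) R 0 k} ≠ ⊤ := by
    refine ne_top_of_le_ne_top ?_ (ENNReal.tsum_le_tsum fun k =>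
      BERW.measure_exists_hitsAtOld_le hS (hle k (BERW.rot s)))
    rw [← ENNReal.ofReal_tsum_of_nonneg hr0 hr]
    exact ENNReal.ofReal_ne_top
  have hzero := measure_setOfPred_frequently_eq_zero hsum
  filter_upwards [compl_mem_ae_iff.2 hzero] with ω hω
  by_contra hinf
  exact hω (BERW.frequently_hitsAtOld hinf)
end

section
/- Let d ≥ 3 and 1 ≤ d₁, d₂ ≤ d with d₁ ≥ 3 and d₂ ≥ 3. Then the two step distributions of the M_d(d₁,d₂) balanced excited random walk (uniform on {±e_1,…,±e_{d₁}} and uniform on {±e_{d−d₂+1},…,±e_d}) satisfy the trace condition tr(Var(μ_i)) > 2·λ_max(Var(μ_i)) with A = I for i = 1, 2, and consequently the M_d(d₁,d₂)-random walk is transient. -/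
open MeasureTheory Filter

open scoped Classical in
/-- The set of steps `±e_i` (as vectors of `ℝ^d`) for indices `i` in the
(`0`-indexed) window `lo ≤ i < hi`. -/
noncomputable def stepFinset (d lo hi : ℕ) : Finset (Fin d → ℝ) :=
  ((Finset.univ.filter fun i : Fin d => lo ≤ i.1 ∧ i.1 < hi).image
      (fun i => fun j => if j = i then (1 : ℝ) else 0)) ∪
  ((Finset.univ.filter fun i : Fin d => lo ≤ i.1 ∧ i.1 < hi).image
      (fun i => fun j => if j = i then (-1 : ℝ) else 0))

/-- The covariance matrix of the uniform measure on a finite set `T` of vectors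
of `ℝ^d` (the vectors being centered). -/
noncomputable def covUniform (d : ℕ) (T : Finset (Fin d → ℝ)) :
    Matrix (Fin d) (Fin d) ℝ :=
  Matrix.of fun i j => (∑ v ∈ T, v i * v j) / T.card

/-- The maximal (real) eigenvalue of a matrix. -/
noncomputable def maxEigenvalue (d : ℕ) (B : Matrix (Fin d) (Fin d) ℝ) : ℝ :=
  sSup {t : ℝ | ∃ v : Fin d → ℝ, v ≠ 0 ∧ B.mulVec v = t • v}

theorem one_add_rpow_neg_quarter_le {u : ℝ} (hu : |u| ≤ 1 / 20) :
    (1 + u) ^ (-(1 / 4) : ℝ) ≤ 1 - u / 4 + 11 / 64 * u ^ 2 := by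
  obtain ⟨hl, hr⟩ := abs_le.1 hu
  set p := 1 - u / 4 + 11 / 64 * u ^ 2 with hp
  have hp0 : 0 < p := by nlinarith
  have hu0 : 0 < 1 + u := by linarith
  have horner : ∀ a b : ℝ, |a| ≤ 1 / 2 → |b| ≤ 1 → |a + u * b| ≤ 1 := fun a b ha hb => by
    have := mul_le_mul hu hb (abs_nonneg b) (by norm_num)
    rw [← abs_mul] at this
    linarith [abs_add_le a (u * b)]
  have hp4 : 1 ≤ p ^ 4 * (1 + u) := by
    have hR : |31 / 64 + u * (-549 / 2048 + u * (863 / 4096 + u * (-4455 / 65536 +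
        u * (6897 / 262144 + u * (-70543 / 16777216 + u * (14641 / 16777216))))))| ≤ 1 := by
      refine horner _ _ (by norm_num) <| horner _ _ (by norm_num) <| horner _ _ (by norm_num) <|
        horner _ _ (by norm_num) <| horner _ _ (by norm_num) <| horner _ _ (by norm_num) ?_
      norm_num
    set R := 31 / 64 + u * (-549 / 2048 + u * (863 / 4096 + u * (-4455 / 65536 +
        u * (6897 / 262144 + u * (-70543 / 16777216 + u * (14641 / 16777216)))))) with hRdef
    have e : p ^ 4 * (1 + u) = 1 + u ^ 2 * (1 / 16 + u * R) := by
      rw [hp, hRdef]; ring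
    have hmul := mul_le_mul hu hR (abs_nonneg _) (by norm_num)
    rw [← abs_mul] at hmul
    have : 0 ≤ 1 / 16 + u * R := by linarith [(abs_le.1 hmul).1]
    rw [e]
    nlinarith [mul_nonneg (sq_nonneg u) this]
  calc (1 + u) ^ (-(1 / 4) : ℝ) = ((1 + u)⁻¹) ^ (1 / 4 : ℝ) := by
        rw [Real.rpow_neg hu0.le, Real.inv_rpow hu0.le]
    _ ≤ (p ^ 4) ^ (1 / 4 : ℝ) :=
        Real.rpow_le_rpow (by positivity) (by rwa [inv_le_iff_one_le_mul₀ hu0]) (by norm_num)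
    _ = p := by
        rw [← Real.rpow_natCast, ← Real.rpow_mul hp0.le]; norm_num

/-- The squared Euclidean norm of a lattice point. -/
def sqNorm {d : ℕ} (x : Fin d → ℤ) : ℤ := ∑ j, x j ^ 2

theorem sqNorm_nonneg {d : ℕ} (x : Fin d → ℤ) : 0 ≤ sqNorm x :=
  Finset.sum_nonneg fun _ _ => sq_nonneg _

theorem sqNorm_add_smul_unitVec {d : ℕ} (x : Fin d → ℤ) (i : Fin d) (ε : ℤ) :
    sqNorm (x + ε • unitVec d i) = sqNorm x + (2 * ε * x i + ε ^ 2) := by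
  have h : ∀ j, (x + ε • unitVec d i) j ^ 2 =
      x j ^ 2 + if j = i then 2 * ε * x i + ε ^ 2 else 0 := fun j => by
    by_cases hj : j = i
    · subst hj; simp [unitVec]; ring
    · simp [unitVec, hj]
  simp only [sqNorm, h, Finset.sum_add_distrib, Finset.sum_ite_eq', Finset.mem_univ, if_true]

/-- The Lyapunov function `x ↦ (1000 + ‖x‖²)^(-1/4)`. -/
noncomputable def lyapunov {d : ℕ} (x : Fin d → ℤ) : ℝ :=
  (1000 + (sqNorm x : ℝ)) ^ (-(1 / 4) : ℝ)

theorem one_le_thousand_add_sqNorm {d : ℕ} (x : Fin d → ℤ) : (1 : ℝ) ≤ 1000 + (sqNorm x : ℝ) := by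
  have : (0 : ℝ) ≤ sqNorm x := by exact_mod_cast sqNorm_nonneg x
  linarith

theorem lyapunov_pos {d : ℕ} (x : Fin d → ℤ) : 0 < lyapunov x :=
  Real.rpow_pos_of_pos (by linarith [one_le_thousand_add_sqNorm x]) _

theorem lyapunov_le_one {d : ℕ} (x : Fin d → ℤ) : lyapunov x ≤ 1 :=
  Real.rpow_le_one_of_one_le_of_nonpos (one_le_thousand_add_sqNorm x) (by norm_num)

theorem lyapunov_rpow_neg_four {d : ℕ} (x : Fin d → ℤ) :
    lyapunov x ^ (-4 : ℝ) = 1000 + (sqNorm x : ℝ) := by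
  rw [lyapunov, ← Real.rpow_mul (by linarith [one_le_thousand_add_sqNorm x])]
  norm_num

theorem lyapunov_add_smul_unitVec_le {d : ℕ} (x : Fin d → ℤ) (i : Fin d) (ε : ℤ)
    (hε : ε = 1 ∨ ε = -1) :
    lyapunov (x + ε • unitVec d i) ≤ lyapunov x *
      (1 - (1 + 2 * ε * x i) / (1000 + (sqNorm x : ℝ)) / 4 +
        11 / 64 * ((1 + 2 * ε * x i) / (1000 + (sqNorm x : ℝ))) ^ 2) := by
  have hx : ((x i : ℝ)) ^ 2 ≤ sqNorm x := by
    exact_mod_cast Finset.single_le_sum (f := fun j => x j ^ 2) (fun _ _ => sq_nonneg _)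
      (Finset.mem_univ i)
  set t : ℝ := 1000 + (sqNorm x : ℝ) with ht
  have ht0 : 0 < t := by linarith [one_le_thousand_add_sqNorm x]
  have hu : |(1 + 2 * ε * x i) / t| ≤ 1 / 20 := by
    rw [abs_div, abs_of_pos ht0, div_le_iff₀ ht0, abs_le]
    rcases hε with rfl | rfl <;> push_cast <;> constructor <;>
      nlinarith [sq_nonneg ((x i : ℝ) - 20), sq_nonneg ((x i : ℝ) + 20)]
  have hsq : (1000 + (sqNorm (x + ε • unitVec d i) : ℝ)) = t * (1 + (1 + 2 * ε * x i) / t) := by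
    have : (ε : ℝ) ^ 2 = 1 := by rcases hε with rfl | rfl <;> norm_num
    rw [sqNorm_add_smul_unitVec, mul_add, mul_div_cancel₀ _ ht0.ne']
    push_cast
    rw [this, ht]; ring
  have hu0 : 0 ≤ 1 + (1 + 2 * ε * x i) / t := by linarith [(abs_le.1 hu).1]
  rw [lyapunov, hsq, Real.mul_rpow ht0.le hu0]
  exact mul_le_mul_of_nonneg_left (one_add_rpow_neg_quarter_le hu) (lyapunov_pos x).le

/-- The function `lyapunov` is superharmonic for the simple random walk along any coordinate
subspace of dimension at least three. -/
theorem sum_lyapunov_le {d : ℕ} (x : Fin d → ℤ) (W : Finset (Fin d)) (hW : 3 ≤ W.card) :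
    ∑ i ∈ W, (lyapunov (x + (1 : ℤ) • unitVec d i) + lyapunov (x + (-1 : ℤ) • unitVec d i)) ≤
      2 * W.card * lyapunov x := by
  set t : ℝ := 1000 + (sqNorm x : ℝ) with ht
  have hs : (0 : ℝ) ≤ sqNorm x := by exact_mod_cast sqNorm_nonneg x
  have ht0 : 1000 ≤ t := by linarith
  have hsW : ∑ i ∈ W, (x i : ℝ) ^ 2 ≤ sqNorm x := by
    have : ∑ i ∈ W, x i ^ 2 ≤ sqNorm x :=
      Finset.sum_le_sum_of_subset_of_nonneg (Finset.subset_univ W) fun _ _ _ => sq_nonneg _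
    exact_mod_cast this
  have hm : (3 : ℝ) ≤ W.card := by exact_mod_cast hW
  calc _ ≤ ∑ i ∈ W, lyapunov x *
        (2 - 1 / (2 * t) + 11 / 32 / t ^ 2 + 11 / 8 / t ^ 2 * (x i : ℝ) ^ 2) := by
        refine Finset.sum_le_sum fun i _ => ?_
        refine (add_le_add (lyapunov_add_smul_unitVec_le x i 1 (.inl rfl))
          (lyapunov_add_smul_unitVec_le x i (-1) (.inr rfl))).trans_eq ?_
        rw [← ht]
        push_cast
        field_simp
        ring
    _ = lyapunov x * (W.card * (2 - 1 / (2 * t) + 11 / 32 / t ^ 2) +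
          11 / 8 / t ^ 2 * ∑ i ∈ W, (x i : ℝ) ^ 2) := by
        rw [← Finset.mul_sum, Finset.sum_add_distrib, Finset.sum_const, nsmul_eq_mul,
          ← Finset.mul_sum]
    _ ≤ lyapunov x * (2 * W.card) := by
        refine mul_le_mul_of_nonneg_left ?_ (lyapunov_pos x).le
        have h : 11 / 8 / t ^ 2 * ∑ i ∈ W, (x i : ℝ) ^ 2 ≤ 11 / 8 / t ^ 2 * t :=
          mul_le_mul_of_nonneg_left (by linarith) (by positivity)
        have h2 : W.card * (1 / (2 * t) - 11 / 32 / t ^ 2) ≥ 11 / 8 / t ^ 2 * t := by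
          have e : (W.card : ℝ) * (1 / (2 * t) - 11 / 32 / t ^ 2) - 11 / 8 / t ^ 2 * t =
              (W.card * (t / 2 - 11 / 32) - 11 / 8 * t) / t ^ 2 := by
            field_simp
          have : 0 ≤ (W.card * (t / 2 - 11 / 32) - 11 / 8 * t) / t ^ 2 :=
            div_nonneg (by nlinarith) (by positivity)
          linarith
        linarith
    _ = _ := by ring

/-- Visiting a point infinitely often is incompatible with convergence of `lyapunov` along a
sequence whose squared norm changes at every step. -/
theorem finite_visits_of_tendsto_lyapunov {d : ℕ} {s : ℕ → Fin d → ℤ} {c : ℝ}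
    (hc : Tendsto (fun n => lyapunov (s n)) atTop (nhds c))
    (hs : ∀ n, sqNorm (s (n + 1)) ≠ sqNorm (s n)) (x : Fin d → ℤ) :
    {n | s n = x}.Finite := by
  by_contra hinf
  have hfreq : ∃ᶠ n in atTop, s n = x := Nat.frequently_atTop_iff_infinite.2 hinf
  have hcx : lyapunov x = c := by
    refine tendsto_nhds_unique_of_frequently_eq tendsto_const_nhds hc (hfreq.mono ?_)
    rintro n rfl
    rfl
  have hc0 : c ≠ 0 := hcx ▸ (lyapunov_pos x).ne'
  have hlim : Tendsto (fun n => (1000 + (sqNorm (s n) : ℝ))) atTop (nhds (c ^ (-4 : ℝ))) := by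
    simpa only [lyapunov_rpow_neg_four] using hc.rpow_const (p := -4) (.inl hc0)
  have hdiff := ((hlim.comp (tendsto_add_atTop_nat 1)).sub hlim).eventually
    (Metric.ball_mem_nhds _ one_pos)
  obtain ⟨n, hn⟩ := hdiff.exists
  refine hs n ?_
  simp only [sub_self, Function.comp_apply, dist_zero_right, Real.norm_eq_abs,
    add_sub_add_left_eq_sub] at hn
  have : |sqNorm (s (n + 1)) - sqNorm (s n)| < 1 := by exact_mod_cast hn
  exact sub_eq_zero.1 (Int.abs_lt_one_iff.1 this)

theorem setIntegral_preimage_le_of_atoms {Ω β : Type*} [MeasurableSpace Ω] {P : Measure Ω}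
    [Countable β] [MeasurableSpace β] [MeasurableSingletonClass β] {H : Ω → β}
    (hH : Measurable H) {F G : Ω → ℝ}
    (hF : Integrable F P) (hG : Integrable G P)
    (h : ∀ b, ∫ ω in H ⁻¹' {b}, F ω ∂P ≤ ∫ ω in H ⁻¹' {b}, G ω ∂P) (B : Set β) :
    ∫ ω in H ⁻¹' B, F ω ∂P ≤ ∫ ω in H ⁻¹' B, G ω ∂P := by
  have hB : H ⁻¹' B = ⋃ b : B, H ⁻¹' {b.1} := by
    ext ω; simp
  have hm : ∀ b : B, MeasurableSet (H ⁻¹' {b.1}) := fun b => hH (measurableSet_singleton _)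
  have hd : Pairwise (Function.onFun Disjoint fun b : B => H ⁻¹' {b.1}) := fun b c hbc =>
    Set.disjoint_left.2 fun ω h1 h2 => hbc (Subtype.ext (h1.symm.trans h2))
  rw [hB]
  exact hasSum_le (fun b : B => h b.1) (hasSum_integral_iUnion hm hd hF.integrableOn)
    (hasSum_integral_iUnion hm hd hG.integrableOn)

theorem card_filter_window {d lo hi : ℕ} (hhi : hi ≤ d) :
    (Finset.univ.filter fun i : Fin d => lo ≤ i.1 ∧ i.1 < hi).card = hi - lo := by
  rw [← Nat.card_Ico lo hi, ← Finset.card_map Fin.valEmbedding]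
  congr 1
  ext k
  simp only [Finset.mem_map, Finset.mem_filter, Finset.mem_univ, true_and, Fin.valEmbedding_apply,
    Finset.mem_Ico]
  exact ⟨by rintro ⟨i, hi, rfl⟩; exact hi, fun hk => ⟨⟨k, by omega⟩, hk, rfl⟩⟩

section UniformStep

variable {Ω α ι : Type*} [MeasurableSpace Ω] {P : Measure Ω} [IsFiniteMeasure P]
  [MeasurableSpace α] [MeasurableSingletonClass α] {X : Ω → α} {E : Set Ω} {T : Finset ι}
  {y : ι → α}

theorem biUnion_inter_preimage_ae_eq (hX : Measurable X) (hE : MeasurableSet E)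
    (hT : T.Nonempty) (hy : Set.InjOn y T)
    (hP : ∀ i ∈ T, P (E ∩ X ⁻¹' {y i}) = P E / T.card) :
    (⋃ i ∈ T, E ∩ X ⁻¹' {y i} : Set Ω) =ᵐ[P] E := by
  have hmeas : ∀ i ∈ T, MeasurableSet (E ∩ X ⁻¹' {y i}) := fun i _ =>
    hE.inter (hX (measurableSet_singleton _))
  refine ae_eq_of_ae_subset_of_measure_ge
    (Eventually.of_forall (Set.iUnion₂_subset fun i _ => Set.inter_subset_left)) ?_
    (T.measurableSet_biUnion hmeas).nullMeasurableSet (measure_ne_top _ _)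
  rw [measure_biUnion_finset _ hmeas, Finset.sum_congr rfl hP, Finset.sum_const, nsmul_eq_mul,
    ENNReal.mul_div_cancel (by simpa using hT.ne_empty) (ENNReal.natCast_ne_top _)]
  intro i hi j hj hij
  refine Set.disjoint_left.2 fun ω h1 h2 => hij (hy hi hj ?_)
  exact h1.2.symm.trans h2.2

theorem setIntegral_uniform_step (hX : Measurable X) (hE : MeasurableSet E)
    (hT : T.Nonempty) (hy : Set.InjOn y T)
    (hP : ∀ i ∈ T, P (E ∩ X ⁻¹' {y i}) = P E / T.card) (f : α → ℝ) :
    ∫ ω in E, f (X ω) ∂P = P.real E / T.card * ∑ i ∈ T, f (y i) := by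
  have hmeas : ∀ i ∈ T, MeasurableSet (E ∩ X ⁻¹' {y i}) := fun i _ =>
    hE.inter (hX (measurableSet_singleton _))
  have hcongr : ∀ i ∈ T, Set.EqOn (fun ω => f (X ω)) (fun _ => f (y i)) (E ∩ X ⁻¹' {y i}) :=
    fun i _ ω hω => congrArg f hω.2
  rw [← setIntegral_congr_set (biUnion_inter_preimage_ae_eq hX hE hT hy hP),
    integral_biUnion_finset _ hmeas, Finset.mul_sum]
  · refine Finset.sum_congr rfl fun i hi => ?_
    rw [setIntegral_congr_fun (hmeas i hi) (hcongr i hi), setIntegral_const, measureReal_def,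
      hP i hi, ENNReal.toReal_div, measureReal_def]
    simp
  · intro i hi j hj hij
    refine Set.disjoint_left.2 fun ω h1 h2 => hij (hy hi hj ?_)
    exact h1.2.symm.trans h2.2
  · exact fun i hi => (integrableOn_const (measure_ne_top _ _)).congr_fun
      (hcongr i hi).symm (hmeas i hi)

theorem ae_mem_uniform_step (hX : Measurable X) (hE : MeasurableSet E)
    (hT : T.Nonempty) (hy : Set.InjOn y T)
    (hP : ∀ i ∈ T, P (E ∩ X ⁻¹' {y i}) = P E / T.card) :
    ∀ᵐ ω ∂P, ω ∈ E → ∃ i ∈ T, X ω = y i := by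
  filter_upwards [(biUnion_inter_preimage_ae_eq hX hE hT hy hP).mem_iff] with ω hω hωE
  obtain ⟨i, hi, hωi⟩ := Set.mem_iUnion₂.1 (hω.2 hωE)
  exact ⟨i, hi, hωi.2⟩

end UniformStep

section Walk

variable {Ω : Type*} [MeasurableSpace Ω] {d d₁ d₂ : ℕ} {P : Measure Ω} {S : ℕ → Ω → Fin d → ℤ}

/-- The trajectory of `S` up to time `n`. -/
def pathUpTo (S : ℕ → Ω → Fin d → ℤ) (n : ℕ) (ω : Ω) : Fin (n + 1) → Fin d → ℤ := fun k => S k ω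

theorem measurable_pathUpTo (hS : ∀ n, Measurable (S n)) (n : ℕ) : Measurable (pathUpTo S n) :=
  measurable_pi_lambda _ fun k => hS k

/-- The filtration generated by the trajectories of `S`. -/
def pathFiltration {Ω : Type*} {mΩ : MeasurableSpace Ω} {d : ℕ} (S : ℕ → Ω → Fin d → ℤ)
    (hS : ∀ n, Measurable (S n)) : Filtration ℕ mΩ where
  seq n := MeasurableSpace.comap (pathUpTo S n) inferInstance
  mono' n m hnm := by
    have : pathUpTo S n =
        (fun (p : Fin (m + 1) → Fin d → ℤ) (k : Fin (n + 1)) => p ⟨k, by omega⟩) ∘ pathUpTo S m :=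
      rfl
    beta_reduce
    rw [this, ← MeasurableSpace.comap_comp]
    exact MeasurableSpace.comap_mono
      (measurable_pi_lambda _ fun k => measurable_pi_apply _).comap_le
  le' n := (measurable_pathUpTo hS n).comap_le

/-- Given its past, the walk makes a uniform step along a coordinate subspace of dimension at
least three. -/
theorem IsBERW.exists_window (hS : IsBERW d d₁ d₂ P S) (hd₁ : 3 ≤ d₁) (hd₁' : d₁ ≤ d)
    (hd₂ : 3 ≤ d₂) (hd₂' : d₂ ≤ d) (n : ℕ) (p : Fin (n + 1) → Fin d → ℤ) :
    ∃ W : Finset (Fin d), 3 ≤ W.card ∧ ∀ q ∈ W ×ˢ ({1, -1} : Finset ℤ),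
      P (pathUpTo S n ⁻¹' {p} ∩ S (n + 1) ⁻¹' {p (Fin.last n) + q.2 • unitVec d q.1}) =
        P (pathUpTo S n ⁻¹' {p}) / (W ×ˢ ({1, -1} : Finset ℤ)).card := by
  let h : ℕ → Fin d → ℤ := fun k => if hk : k < n + 1 then p ⟨k, hk⟩ else 0
  have hn : h n = p (Fin.last n) := by simp [h, Fin.last]
  have hE : pathUpTo S n ⁻¹' {p} = {ω | ∀ k ≤ n, S k ω = h k} := by
    ext ω
    simp only [Set.mem_preimage, Set.mem_singleton_iff, Set.mem_ofPred_eq, funext_iff, pathUpTo]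
    refine ⟨fun hω k hk j => ?_, fun hω k j => ?_⟩
    · simpa [h, hk] using hω ⟨k, Nat.lt_succ_of_le hk⟩ j
    · simpa [h, Nat.le_of_lt_succ k.2] using hω k (Nat.le_of_lt_succ k.2) j
  have hE' : ∀ v, pathUpTo S n ⁻¹' {p} ∩ S (n + 1) ⁻¹' {p (Fin.last n) + v} =
      {ω | (∀ k ≤ n, S k ω = h k) ∧ S (n + 1) ω = h n + v} := fun v => by
    rw [hE, hn]; rfl
  simp only [hE', Finset.card_product, Finset.mem_product, Finset.mem_insert,
    Finset.mem_singleton, Finset.card_pair (show (1 : ℤ) ≠ -1 by decide)]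
  rw [hE]
  by_cases hnew : ∀ k < n, h n ≠ h k
  · have hcard := card_filter_window (lo := 0) hd₁'
    rw [Nat.sub_zero] at hcard
    refine ⟨_, hcard.symm ▸ hd₁, fun q hq => ?_⟩
    rw [hcard, hS.2.2.1 n h hnew q.1 (by simpa using hq.1) q.2 hq.2, Nat.cast_mul, Nat.cast_two,
      mul_comm]
  · push Not at hnew
    have hcard := card_filter_window (lo := d - d₂) (le_refl d)
    rw [Nat.sub_sub_self hd₂'] at hcard
    refine ⟨_, hcard.symm ▸ hd₂, fun q hq => ?_⟩
    rw [hcard, hS.2.2.2 n h hnew q.1 (Finset.mem_filter.1 hq.1).2.1 q.2 hq.2, Nat.cast_mul,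
      Nat.cast_two, mul_comm]

theorem injOn_add_smul_unitVec (x : Fin d → ℤ) (W : Finset (Fin d)) :
    Set.InjOn (fun q : Fin d × ℤ => x + q.2 • unitVec d q.1)
      (W ×ˢ ({1, -1} : Finset ℤ) : Finset (Fin d × ℤ)) := by
  rintro ⟨i, ε⟩ hi ⟨j, δ⟩ hj hij
  have hε : ε ≠ 0 := by
    simp only [Finset.coe_product, Set.mem_prod, Finset.mem_coe, Finset.mem_insert,
      Finset.mem_singleton] at hi
    omega
  have hi' := congrFun (add_left_cancel hij) i
  by_cases h : i = j
  · subst h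
    simpa [unitVec] using hi'
  · simp [unitVec, h, hε] at hi'

theorem IsBERW.ae_sqNorm_ne (hS : IsBERW d d₁ d₂ P S) [IsProbabilityMeasure P]
    (hd₁ : 3 ≤ d₁) (hd₁' : d₁ ≤ d) (hd₂ : 3 ≤ d₂) (hd₂' : d₂ ≤ d) :
    ∀ᵐ ω ∂P, ∀ n, sqNorm (S (n + 1) ω) ≠ sqNorm (S n ω) := by
  refine ae_all_iff.2 fun n => ?_
  have hall : ∀ᵐ ω ∂P, ∀ p : Fin (n + 1) → Fin d → ℤ, pathUpTo S n ω = p →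
      sqNorm (S (n + 1) ω) ≠ sqNorm (p (Fin.last n)) := by
    refine ae_all_iff.2 fun p => ?_
    obtain ⟨W, hW, hP⟩ := hS.exists_window hd₁ hd₁' hd₂ hd₂' n p
    have hT : (W ×ˢ ({1, -1} : Finset ℤ)).Nonempty :=
      (Finset.card_pos.1 (by omega)).product (by simp)
    filter_upwards [ae_mem_uniform_step (hS.1 (n + 1))
      (measurable_pathUpTo hS.1 n (measurableSet_singleton p)) hT
      (injOn_add_smul_unitVec _ W) hP] with ω hω hωp
    obtain ⟨q, hq, hqω⟩ := hω hωp
    rw [hqω, sqNorm_add_smul_unitVec]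
    have : q.2 = 1 ∨ q.2 = -1 := by simpa using (Finset.mem_product.1 hq).2
    rcases this with h | h <;> rw [h] <;> omega
  filter_upwards [hall] with ω hω
  exact hω _ rfl

theorem IsBERW.submartingale_neg_lyapunov (hS : IsBERW d d₁ d₂ P S) [IsProbabilityMeasure P]
    (hd₁ : 3 ≤ d₁) (hd₁' : d₁ ≤ d) (hd₂ : 3 ≤ d₂) (hd₂' : d₂ ≤ d) :
    Submartingale (fun n ω => -lyapunov (S n ω)) (pathFiltration S hS.1) P := by
  have hint : ∀ n, Integrable (fun ω => -lyapunov (S n ω)) P := fun n => by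
    refine Integrable.of_bound (C := 1)
      ((Measurable.of_discrete (f := fun x : Fin d → ℤ => -lyapunov x)).comp
        (hS.1 n)).aestronglyMeasurable
      (Eventually.of_forall fun ω => ?_)
    rw [norm_neg, Real.norm_of_nonneg (lyapunov_pos _).le]
    exact lyapunov_le_one _
  refine submartingale_of_setIntegral_le_succ (fun n => ?_) hint fun n s hs => ?_
  · have hf : Measurable fun p : Fin (n + 1) → Fin d → ℤ => -lyapunov (p (Fin.last n)) :=
      Measurable.of_discrete
    exact (hf.comp (comap_measurable (pathUpTo S n))).stronglyMeasurable
  · obtain ⟨B, -, rfl⟩ := hs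
    refine setIntegral_preimage_le_of_atoms (measurable_pathUpTo hS.1 n) (hint n) (hint (n + 1))
      (fun p => ?_) B
    obtain ⟨W, hW, hP⟩ := hS.exists_window hd₁ hd₁' hd₂ hd₂' n p
    have hT : (W ×ˢ ({1, -1} : Finset ℤ)).Nonempty :=
      (Finset.card_pos.1 (by omega)).product (by simp)
    have hE := measurable_pathUpTo hS.1 n (measurableSet_singleton p)
    have hnow : Set.EqOn (fun ω => lyapunov (S n ω)) (fun _ => lyapunov (p (Fin.last n)))
        (pathUpTo S n ⁻¹' {p}) := by
      rintro ω rfl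
      rfl
    rw [integral_neg, integral_neg, neg_le_neg_iff, setIntegral_congr_fun hE hnow,
      setIntegral_const, setIntegral_uniform_step (hS.1 (n + 1)) hE hT
        (injOn_add_smul_unitVec _ W) hP lyapunov, Finset.sum_product]
    simp only [Finset.sum_pair (show (1 : ℤ) ≠ -1 by decide), Finset.card_product,
      Finset.card_pair (show (1 : ℤ) ≠ -1 by decide)]
    have hm : (0 : ℝ) < W.card := by exact_mod_cast (by omega : 0 < W.card)
    refine (mul_le_mul_of_nonneg_left (sum_lyapunov_le (p (Fin.last n)) W hW)
      (by positivity)).trans_eq ?_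
    push_cast
    rw [smul_eq_mul]
    field_simp

theorem IsBERW.isTransientWalk (hS : IsBERW d d₁ d₂ P S) [IsProbabilityMeasure P]
    (hd₁ : 3 ≤ d₁) (hd₁' : d₁ ≤ d) (hd₂ : 3 ≤ d₂) (hd₂' : d₂ ≤ d) : IsTransientWalk d P S := by
  have hsub := hS.submartingale_neg_lyapunov hd₁ hd₁' hd₂ hd₂'
  have hbdd : ∀ n, eLpNorm (fun ω => -lyapunov (S n ω)) 1 P ≤ (1 : NNReal) := fun n => by
    refine (eLpNorm_le_of_ae_bound (C := 1) (Eventually.of_forall fun ω => ?_)).trans (by simp)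
    rw [norm_neg, Real.norm_of_nonneg (lyapunov_pos _).le]
    exact lyapunov_le_one _
  filter_upwards [hsub.exists_ae_tendsto_of_bdd hbdd,
    hS.ae_sqNorm_ne hd₁ hd₁' hd₂ hd₂'] with ω hlim hne x
  obtain ⟨c, hc⟩ := hlim
  exact finite_visits_of_tendsto_lyapunov (by simpa using hc.neg) hne x

end Walk

section Trace

theorem sum_stepFinset {d lo hi : ℕ} (F : (Fin d → ℝ) → ℝ) :
    ∑ v ∈ stepFinset d lo hi, F v =
      ∑ i : Fin d with lo ≤ i.1 ∧ i.1 < hi, (F (Pi.single i 1) + F (Pi.single i (-1))) := by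
  classical
  have hform : ∀ a : ℝ, (fun i j : Fin d => if j = i then a else 0) = fun i => Pi.single i a :=
    fun a => by ext i j; simp [Pi.single_apply]
  have hinj : ∀ a : ℝ, a ≠ 0 → Function.Injective fun i : Fin d => (Pi.single i a : Fin d → ℝ) :=
    fun a ha i j hij => by
      by_contra hne
      have := congrFun hij i
      simp [hne, ha] at this
  rw [stepFinset, hform, hform, Finset.sum_union, Finset.sum_image (hinj 1 (by simp)).injOn,
    Finset.sum_image (hinj (-1) (by simp)).injOn, Finset.sum_add_distrib]
  rw [Finset.disjoint_left]
  intro v h1 h2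
  obtain ⟨i, -, rfl⟩ := Finset.mem_image.1 h1
  obtain ⟨j, -, hj⟩ := Finset.mem_image.1 h2
  have := congrFun hj i
  simp only [Pi.single_apply] at this
  split_ifs at this <;> norm_num at this

theorem card_stepFinset {d lo hi : ℕ} (hhi : hi ≤ d) :
    ((stepFinset d lo hi).card : ℝ) = (hi - lo : ℕ) * 2 := by
  have h := sum_stepFinset (d := d) (lo := lo) (hi := hi) fun _ => 1
  rw [Finset.sum_const, Finset.sum_const, card_filter_window hhi] at h
  simpa [one_add_one_eq_two] using h

theorem covUniform_stepFinset {d lo hi : ℕ} (hhi : hi ≤ d) :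
    covUniform d (stepFinset d lo hi) =
      Matrix.diagonal fun i => if lo ≤ i.1 ∧ i.1 < hi then (1 : ℝ) / (hi - lo : ℕ) else 0 := by
  ext a b
  have hterm : ∀ i : Fin d, (Pi.single i 1 : Fin d → ℝ) a * (Pi.single i 1 : Fin d → ℝ) b +
      (Pi.single i (-1) : Fin d → ℝ) a * (Pi.single i (-1) : Fin d → ℝ) b =
      if a = i then (if a = b then 2 else 0) else 0 := fun i => by
    by_cases ha : a = i
    · subst ha
      by_cases hb : a = b
      · subst hb; norm_num
      · simp [hb, Ne.symm hb]
    · simp [Pi.single_apply, ha]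
  rw [covUniform, Matrix.of_apply, sum_stepFinset fun v => v a * v b, card_stepFinset hhi,
    Finset.sum_congr rfl fun i _ => hterm i, Finset.sum_ite_eq, Matrix.diagonal_apply]
  by_cases hab : a = b
  · subst hab
    by_cases hw : lo ≤ a.1 ∧ a.1 < hi
    · have : (0 : ℝ) < (hi - lo : ℕ) := by exact_mod_cast (by omega : 0 < hi - lo)
      simp only [Finset.mem_filter, Finset.mem_univ, hw, and_self, if_true]
      field_simp
    · simp [hw]
  · simp [hab]

/-- The trace condition for the uniform distribution on `±e_i` with `i` in a window of length at
least three. -/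
theorem two_mul_maxEigenvalue_lt_trace {d lo hi : ℕ} (hhi : hi ≤ d) (hm : 3 ≤ hi - lo) :
    2 * maxEigenvalue d (covUniform d (stepFinset d lo hi)) <
      Matrix.trace (covUniform d (stepFinset d lo hi)) := by
  have hm' : (3 : ℝ) ≤ (hi - lo : ℕ) := by exact_mod_cast hm
  have hm0 : (0 : ℝ) < (hi - lo : ℕ) := by linarith
  have hmax : maxEigenvalue d (covUniform d (stepFinset d lo hi)) ≤ 1 / (hi - lo : ℕ) := by
    refine Real.sSup_le ?_ (by positivity)
    rintro t ⟨v, hv, hvt⟩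
    obtain ⟨i, hi⟩ := Function.ne_iff.1 hv
    have hti := congrFun hvt i
    rw [covUniform_stepFinset hhi, Matrix.mulVec_diagonal, Pi.smul_apply, smul_eq_mul] at hti
    rw [← mul_right_cancel₀ hi hti]
    split_ifs
    · exact le_rfl
    · positivity
  have htrace : Matrix.trace (covUniform d (stepFinset d lo hi)) = 1 := by
    rw [covUniform_stepFinset hhi, Matrix.trace_diagonal, ← Finset.sum_filter, Finset.sum_const,
      card_filter_window hhi, nsmul_eq_mul, mul_one_div_cancel hm0.ne']
  have : 1 / ((hi - lo : ℕ) : ℝ) ≤ 1 / 3 := one_div_le_one_div_of_le (by norm_num) hm'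
  linarith

end Trace

/-- If `d ≥ 3`, `d₁ ≥ 3` and `d₂ ≥ 3`, then the two step distributions of the
`M_d(d₁,d₂)` balanced excited random walk (uniform on `{±e_1,…,±e_{d₁}}` and on
`{±e_{d−d₂+1},…,±e_d}`) satisfy the trace condition `tr(Var μᵢ) > 2 λ_max(Var μᵢ)`
(with `A = I`), and consequently the walk is transient. -/
theorem berw_transient_of_trace_condition {Ω : Type*} [MeasurableSpace Ω]
    (P : Measure Ω) [IsProbabilityMeasure P] (d d₁ d₂ : ℕ)
    (hd : 3 ≤ d) (hd₁ : 3 ≤ d₁) (hd₁' : d₁ ≤ d) (hd₂ : 3 ≤ d₂) (hd₂' : d₂ ≤ d)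
    (S : ℕ → Ω → Fin d → ℤ) (hS : IsBERW d d₁ d₂ P S) :
    (2 * maxEigenvalue d (covUniform d (stepFinset d 0 d₁))
        < Matrix.trace (covUniform d (stepFinset d 0 d₁))) ∧
    (2 * maxEigenvalue d (covUniform d (stepFinset d (d - d₂) d))
        < Matrix.trace (covUniform d (stepFinset d (d - d₂) d))) ∧
    IsTransientWalk d P S := by
  refine ⟨two_mul_maxEigenvalue_lt_trace hd₁' (by omega),
    two_mul_maxEigenvalue_lt_trace le_rfl (by omega), hS.isTransientWalk hd₁ hd₁' hd₂ hd₂'⟩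
end
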